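/- arXiv:math/0701888 — 8 statements merged into one kernel-verified Lean document; each statement's English description precedes it below -/
import Mathlib

section
/- The tail-averaging (Hardy-type) operator H², defined by (H²f)(s) = (A(T) − A(s))⁻¹ ∫_s^T f(u) z(u)² du for s ∈ [0,T), is a bounded linear operator on L²_T: for every f ∈ L²_T one has ∫₀^T ( (A(T) − A(s))⁻¹ ∫_s^T f(u) z(u)² du )² z(s)² ds ≤ 4 ∫₀^T f(s)² z(s)² ds. -/
open MeasureTheory Set Filter Topology

/-- The mass that a measure on the line gives to the open half-line to the right of a point. -/
noncomputable def rightTail (μ : Measure ℝ) (s : ℝ) : ℝ := μ.real (Ioi s)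

section RightTail

variable (μ : Measure ℝ)

lemma rightTail_nonneg (s : ℝ) : 0 ≤ rightTail μ s := measureReal_nonneg

lemma rightTail_eq_measureReal_Ici [NullSingletonClass μ] (s : ℝ) :
    rightTail μ s = μ.real (Ici s) :=
  measureReal_congr Ioi_ae_eq_Ici

variable [IsFiniteMeasure μ]

lemma antitone_rightTail : Antitone (rightTail μ) := fun _ _ h =>
  measureReal_mono (Ioi_subset_Ioi h)

lemma measurable_rightTail : Measurable (rightTail μ) := (antitone_rightTail μ).measurable

lemma rightTail_le (s : ℝ) : rightTail μ s ≤ μ.real univ := measureReal_mono (subset_univ _)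

lemma tendsto_rightTail_atTop : Tendsto (rightTail μ) atTop (𝓝 0) := by
  have h : rightTail μ = fun s => μ.real univ - μ.real (Iic s) := by
    ext s
    rw [← measureReal_compl measurableSet_Iic, compl_Iic, rightTail]
  have h1 : Tendsto (fun s => μ.real (Iic s)) atTop (𝓝 (μ.real univ)) :=
    (ENNReal.tendsto_toReal (measure_ne_top μ univ)).comp (tendsto_measure_Iic_atTop μ)
  rw [h]
  simpa using h1.const_sub (μ.real univ)

variable [NullSingletonClass μ]

lemma tendsto_rightTail_atBot : Tendsto (rightTail μ) atBot (𝓝 (μ.real univ)) := by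
  rw [funext (rightTail_eq_measureReal_Ici μ)]
  exact (ENNReal.tendsto_toReal (measure_ne_top μ univ)).comp (tendsto_measure_Ici_atBot μ)

lemma continuous_rightTail : Continuous (rightTail μ) := by
  rw [continuous_iff_continuousAt]
  intro x
  have h := MeasureTheory.IntegrableOn.continuousOn_Ici_primitive_Ioi (μ := μ)
    (f := fun _ => (1 : ℝ)) (a₀ := x - 1) (integrable_const _).integrableOn
  have h2 : rightTail μ = fun s => ∫ _ in Ioi s, (1 : ℝ) ∂μ := by
    ext s
    simp [rightTail]
  rw [h2]
  exact h.continuousAt (Ici_mem_nhds (by linarith))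

lemma measure_rightTail_le {c : ℝ} (hcM : c < μ.real univ) :
    μ {s | rightTail μ s ≤ c} = ENNReal.ofReal c := by
  have hcl : IsClosed {s | rightTail μ s ≤ c} :=
    isClosed_le (continuous_rightTail μ) continuous_const
  rcases eq_empty_or_nonempty {s | rightTail μ s ≤ c} with he | hne
  · have : c ≤ 0 := ge_of_tendsto' (tendsto_rightTail_atTop μ) fun s =>
      (not_le.1 fun h => (he ▸ h : s ∈ (∅ : Set ℝ))).le
    rw [he, measure_empty, ENNReal.ofReal_of_nonpos this]
  · obtain ⟨r, hr⟩ := ((tendsto_rightTail_atBot μ).eventually_const_lt hcM).exists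
    have hbdd : BddBelow {s | rightTail μ s ≤ c} := ⟨r, fun s hs => le_of_lt <| not_le.1 fun h =>
      (hr.trans_le (antitone_rightTail μ h)).not_ge hs⟩
    set a := sInf {s | rightTail μ s ≤ c}
    have ha : rightTail μ a ≤ c := hcl.csInf_mem hne hbdd
    have hle : c ≤ rightTail μ a := by
      have ht : Tendsto (rightTail μ) (𝓝[<] a) (𝓝 (rightTail μ a)) :=
        (continuous_rightTail μ).continuousWithinAt
      refine ge_of_tendsto ht ?_
      filter_upwards [self_mem_nhdsWithin] with s hs
      exact (not_le.1 fun h => (csInf_le hbdd h).not_gt hs).le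
    have hset : {s | rightTail μ s ≤ c} = Ici a := by
      ext s
      exact ⟨fun h => csInf_le hbdd h, fun h => (antitone_rightTail μ h).trans ha⟩
    rw [hset, ← le_antisymm ha hle, rightTail_eq_measureReal_Ici, ofReal_measureReal]

/-- The right tail of an atomless finite measure is uniformly distributed. -/
lemma map_rightTail : μ.map (rightTail μ) = volume.restrict (Ioc 0 (μ.real univ)) := by
  have hm := measurable_rightTail μ
  refine Measure.ext_of_Iic _ _ fun c => ?_
  rw [Measure.map_apply hm measurableSet_Iic, Measure.restrict_apply measurableSet_Iic,
    inter_comm, Ioc_inter_Iic, Real.volume_Ioc, sub_zero]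
  rcases lt_or_ge c (μ.real univ) with hcM | hcM
  · rw [min_eq_right hcM.le]
    exact measure_rightTail_le μ hcM
  · have : rightTail μ ⁻¹' Iic c = univ := by
      ext s
      simpa using (rightTail_le μ s).trans hcM
    rw [this, min_eq_left hcM, ofReal_measureReal]

lemma ae_rightTail_pos : ∀ᵐ s ∂μ, 0 < rightTail μ s := by
  have h : ∀ᵐ x ∂(μ.map (rightTail μ)), 0 < x := by
    rw [map_rightTail]
    filter_upwards [ae_restrict_mem measurableSet_Ioc] with x hx using hx.1
  exact ae_of_ae_map (measurable_rightTail μ).aemeasurable h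

lemma setLIntegral_Ioi_comp_rightTail_le {g : ℝ → ENNReal} (hg : Measurable g) (s : ℝ) :
    ∫⁻ u in Ioi s, g (rightTail μ u) ∂μ ≤ ∫⁻ x in Ioc 0 (rightTail μ s), g x := by
  calc ∫⁻ u in Ioi s, g (rightTail μ u) ∂μ
      ≤ ∫⁻ u in rightTail μ ⁻¹' Iic (rightTail μ s), g (rightTail μ u) ∂μ :=
        lintegral_mono_set fun u hu => antitone_rightTail μ (le_of_lt hu)
    _ = ∫⁻ x in Iic (rightTail μ s) ∩ Ioc 0 (μ.real univ), g x := by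
        rw [← setLIntegral_map measurableSet_Iic hg (measurable_rightTail μ), map_rightTail,
          Measure.restrict_restrict measurableSet_Iic]
    _ ≤ ∫⁻ x in Ioc 0 (rightTail μ s), g x :=
        lintegral_mono_set fun x hx => ⟨hx.2.1, hx.1⟩

lemma setLIntegral_Iio_comp_rightTail_le {g : ℝ → ENNReal} (hg : Measurable g) (u : ℝ) :
    ∫⁻ s in Iio u, g (rightTail μ s) ∂μ ≤ ∫⁻ x in Ioi (rightTail μ u), g x := by
  calc ∫⁻ s in Iio u, g (rightTail μ s) ∂μ
      ≤ ∫⁻ s in rightTail μ ⁻¹' Ici (rightTail μ u), g (rightTail μ s) ∂μ :=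
        lintegral_mono_set fun s hs => antitone_rightTail μ (le_of_lt hs)
    _ = ∫⁻ x in Ici (rightTail μ u) ∩ Ioc 0 (μ.real univ), g x := by
        rw [← setLIntegral_map measurableSet_Ici hg (measurable_rightTail μ), map_rightTail,
          Measure.restrict_restrict measurableSet_Ici]
    _ ≤ ∫⁻ x in Ici (rightTail μ u), g x := lintegral_mono_set inter_subset_left
    _ = ∫⁻ x in Ioi (rightTail μ u), g x := setLIntegral_congr Ioi_ae_eq_Ici.symm

end RightTail

lemma setLIntegral_Ioc_rpow_neg_half {b : ℝ} (hb : 0 ≤ b) :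
    ∫⁻ x in Ioc 0 b, ENNReal.ofReal (x ^ (-1 / 2 : ℝ)) = ENNReal.ofReal (2 * b ^ (1 / 2 : ℝ)) := by
  have hi : IntegrableOn (fun x : ℝ => x ^ (-1 / 2 : ℝ)) (Ioc 0 b) :=
    (intervalIntegrable_iff_integrableOn_Ioc_of_le hb).1
      (intervalIntegral.intervalIntegrable_rpow' (by norm_num))
  rw [← ofReal_integral_eq_lintegral_ofReal hi, ← intervalIntegral.integral_of_le hb,
    integral_rpow (Or.inl (by norm_num))]
  · congr 1
    norm_num
    ring
  · filter_upwards [ae_restrict_mem measurableSet_Ioc] with x hx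
    exact Real.rpow_nonneg hx.1.le _

lemma setLIntegral_Ioi_rpow_neg_three_halves {b : ℝ} (hb : 0 < b) :
    ∫⁻ x in Ioi b, ENNReal.ofReal (x ^ (-3 / 2 : ℝ)) = ENNReal.ofReal (2 * b ^ (-1 / 2 : ℝ)) := by
  rw [← ofReal_integral_eq_lintegral_ofReal
    (integrableOn_Ioi_rpow_of_lt (by norm_num) hb),
    integral_Ioi_rpow_of_lt (by norm_num) hb]
  · congr 1
    norm_num
    ring
  · filter_upwards [ae_restrict_mem measurableSet_Ioi] with x hx
    exact Real.rpow_nonneg (hb.trans hx).le _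

lemma sq_lintegral_mul_le {α : Type*} [MeasurableSpace α] (μ : Measure α) {f g : α → ENNReal}
    (hf : AEMeasurable f μ) (hg : AEMeasurable g μ) :
    (∫⁻ a, f a * g a ∂μ) ^ 2 ≤ (∫⁻ a, f a ^ 2 ∂μ) * ∫⁻ a, g a ^ 2 ∂μ := by
  have h := ENNReal.lintegral_mul_le_Lp_mul_Lq μ Real.HolderConjugate.two_two hf hg
  simp only [Pi.mul_apply, ENNReal.rpow_two] at h
  calc (∫⁻ a, f a * g a ∂μ) ^ 2
      ≤ ((∫⁻ a, f a ^ 2 ∂μ) ^ (1 / 2 : ℝ) * (∫⁻ a, g a ^ 2 ∂μ) ^ (1 / 2 : ℝ)) ^ 2 := by gcongr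
    _ = _ := by
        rw [mul_pow, ← ENNReal.rpow_two, ← ENNReal.rpow_two, ← ENNReal.rpow_mul,
          ← ENNReal.rpow_mul]
        norm_num

section Hardy

variable (μ : Measure ℝ) [IsFiniteMeasure μ] [NullSingletonClass μ]

lemma sq_setLIntegral_Ioi_le {f : ℝ → ENNReal} (hf : Measurable f) (s : ℝ) :
    (∫⁻ u in Ioi s, f u ∂μ) ^ 2 ≤
      (∫⁻ u in Ioi s, f u ^ 2 * ENNReal.ofReal (rightTail μ u ^ (1 / 2 : ℝ)) ∂μ) *
        ENNReal.ofReal (2 * rightTail μ s ^ (1 / 2 : ℝ)) := by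
  have hb := measurable_rightTail μ
  have hpos := ae_restrict_of_ae (s := Ioi s) (ae_rightTail_pos μ)
  have h1 : ∫⁻ u in Ioi s, f u ∂μ = ∫⁻ u in Ioi s,
      (f u * ENNReal.ofReal (rightTail μ u ^ (1 / 4 : ℝ))) *
        ENNReal.ofReal (rightTail μ u ^ (-1 / 4 : ℝ)) ∂μ := by
    refine lintegral_congr_ae ?_
    filter_upwards [hpos] with u hu
    rw [mul_assoc, ← ENNReal.ofReal_mul (by positivity), ← Real.rpow_add hu]
    norm_num
  rw [h1]
  refine (sq_lintegral_mul_le _ (by fun_prop) (by fun_prop)).trans ?_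
  refine mul_le_mul' (le_of_eq ?_) ?_
  · refine lintegral_congr fun u => ?_
    rw [mul_pow, ← ENNReal.ofReal_pow (Real.rpow_nonneg (rightTail_nonneg μ u) _),
      ← Real.rpow_mul_natCast (rightTail_nonneg μ u)]
    norm_num
  · rw [← setLIntegral_Ioc_rpow_neg_half (rightTail_nonneg μ s)]
    refine le_trans (le_of_eq ?_) (setLIntegral_Ioi_comp_rightTail_le μ (by fun_prop) s)
    refine lintegral_congr fun u => ?_
    rw [← ENNReal.ofReal_pow (Real.rpow_nonneg (rightTail_nonneg μ u) _),
      ← Real.rpow_mul_natCast (rightTail_nonneg μ u)]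
    norm_num

/-- Hardy's inequality for averages over right tails of an atomless finite measure. -/
lemma lintegral_sq_tailAverage_le {f : ℝ → ENNReal} (hf : Measurable f) :
    ∫⁻ s, ((ENNReal.ofReal (rightTail μ s))⁻¹ * ∫⁻ u in Ioi s, f u ∂μ) ^ 2 ∂μ ≤
      4 * ∫⁻ u, f u ^ 2 ∂μ := by
  have hb := measurable_rightTail μ
  calc ∫⁻ s, ((ENNReal.ofReal (rightTail μ s))⁻¹ * ∫⁻ u in Ioi s, f u ∂μ) ^ 2 ∂μ
      ≤ ∫⁻ s, ∫⁻ u, (Iio u).indicator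
          (fun s => 2 * ENNReal.ofReal (rightTail μ s ^ (-3 / 2 : ℝ))) s *
          (f u ^ 2 * ENNReal.ofReal (rightTail μ u ^ (1 / 2 : ℝ))) ∂μ ∂μ := by
        refine lintegral_mono_ae ?_
        filter_upwards [ae_rightTail_pos μ] with s hs
        have h1 : ∀ u, (Iio u).indicator
            (fun s => 2 * ENNReal.ofReal (rightTail μ s ^ (-3 / 2 : ℝ))) s *
              (f u ^ 2 * ENNReal.ofReal (rightTail μ u ^ (1 / 2 : ℝ))) =
            (Ioi s).indicator (fun u => (2 * ENNReal.ofReal (rightTail μ s ^ (-3 / 2 : ℝ))) *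
              (f u ^ 2 * ENNReal.ofReal (rightTail μ u ^ (1 / 2 : ℝ)))) u := by
          intro u
          by_cases h : s < u <;> simp [indicator, h]
        simp_rw [h1]
        rw [lintegral_indicator measurableSet_Ioi, lintegral_const_mul _ (by fun_prop), mul_pow]
        refine (mul_le_mul_right (sq_setLIntegral_Ioi_le μ hf s) _).trans (le_of_eq ?_)
        rw [mul_left_comm, mul_comm]
        congr 1
        rw [← ENNReal.ofReal_inv_of_pos hs, ← ENNReal.ofReal_pow (by positivity),
          ← ENNReal.ofReal_mul (by positivity), ← ENNReal.ofReal_ofNat 2,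
          ← ENNReal.ofReal_mul (by positivity)]
        congr 1
        rw [inv_pow, ← Real.rpow_natCast, ← Real.rpow_neg hs.le, mul_left_comm,
          ← Real.rpow_add hs]
        norm_num
    _ = ∫⁻ u, ∫⁻ s, (Iio u).indicator
          (fun s => 2 * ENNReal.ofReal (rightTail μ s ^ (-3 / 2 : ℝ))) s *
          (f u ^ 2 * ENNReal.ofReal (rightTail μ u ^ (1 / 2 : ℝ))) ∂μ ∂μ := by
        refine lintegral_lintegral_swap (Measurable.aemeasurable ?_)
        refine Measurable.mul ?_ (by fun_prop)
        exact Measurable.indicator (s := {p : ℝ × ℝ | p.1 < p.2})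
          (f := fun p : ℝ × ℝ => 2 * ENNReal.ofReal (rightTail μ p.1 ^ (-3 / 2 : ℝ)))
          (by fun_prop) (measurableSet_lt measurable_fst measurable_snd)
    _ ≤ ∫⁻ u, 4 * f u ^ 2 ∂μ := by
        refine lintegral_mono_ae ?_
        filter_upwards [ae_rightTail_pos μ] with u hu
        rw [lintegral_mul_const _ (Measurable.indicator (by fun_prop) measurableSet_Iio),
          lintegral_indicator measurableSet_Iio, lintegral_const_mul _ (by fun_prop)]
        have h := setLIntegral_Iio_comp_rightTail_le μ
          (g := fun x => ENNReal.ofReal (x ^ (-3 / 2 : ℝ))) (by fun_prop) u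
        rw [setLIntegral_Ioi_rpow_neg_three_halves hu] at h
        calc _ ≤ 2 * ENNReal.ofReal (2 * rightTail μ u ^ (-1 / 2 : ℝ)) *
              (f u ^ 2 * ENNReal.ofReal (rightTail μ u ^ (1 / 2 : ℝ))) := by gcongr
          _ = (2 * (ENNReal.ofReal (2 * rightTail μ u ^ (-1 / 2 : ℝ)) *
              ENNReal.ofReal (rightTail μ u ^ (1 / 2 : ℝ)))) * f u ^ 2 := by ring
          _ = 4 * f u ^ 2 := by
              rw [← ENNReal.ofReal_mul (by positivity), mul_assoc 2 (_ ^ _), ← Real.rpow_add hu]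
              norm_num
    _ = 4 * ∫⁻ u, f u ^ 2 ∂μ := lintegral_const_mul _ (by fun_prop)

end Hardy

/-- The tail-averaging Hardy-type operator `H²`,
`(H² f)(s) = (A(T) − A(s))⁻¹ ∫ₛᵀ f(u) z(u)² du`,
is bounded on the weighted space `L²([0,T], z(s)² ds)` with norm at most 2. -/
theorem hardy_operator_H2_bounded
    (T : ℝ) (hT : 0 < T)
    (z : ℝ → ℝ) (hz : Measurable z)
    (hz2 : IntegrableOn (fun s => z s ^ 2) (Set.Ioc 0 T))
    (hzne : ∀ᵐ s ∂(volume.restrict (Set.Ioc 0 T)), z s ≠ 0)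
    (A : ℝ → ℝ) (hA : ∀ t, A t = ∫ s in (0:ℝ)..t, z s ^ 2)
    (f : ℝ → ℝ) (hf : Measurable f)
    (hfL2 : IntegrableOn (fun s => f s ^ 2 * z s ^ 2) (Set.Ioc 0 T)) :
    (∫ s in (0:ℝ)..T, ((A T - A s)⁻¹ * ∫ u in s..T, f u * z u ^ 2) ^ 2 * z s ^ 2)
      ≤ 4 * ∫ s in (0:ℝ)..T, f s ^ 2 * z s ^ 2 := by
  set w : ℝ → ENNReal := fun s => ENNReal.ofReal (z s ^ 2) with hw
  have hwm : Measurable w := by fun_prop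
  set μ : Measure ℝ := (volume.restrict (Ioc 0 T)).withDensity w with hμ
  have : IsFiniteMeasure μ := isFiniteMeasure_withDensity_ofReal hz2.2
  have hIoi : ∀ s ∈ Ioc 0 T, ∀ g : ℝ → ENNReal, Measurable g →
      ∫⁻ u in Ioi s, g u ∂μ = ∫⁻ u in Ioc s T, w u * g u := by
    intro s hs g hg
    rw [hμ, setLIntegral_withDensity_eq_setLIntegral_mul _ hwm hg measurableSet_Ioi,
      Measure.restrict_restrict measurableSet_Ioi, inter_comm, Ioc_inter_Ioi,
      max_eq_right hs.1.le]
    rfl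
  have htail : ∀ s ∈ Ioc 0 T, A T - A s = rightTail μ s := by
    intro s hs
    have h0T : IntervalIntegrable (fun s => z s ^ 2) volume 0 T :=
      (intervalIntegrable_iff_integrableOn_Ioc_of_le hT.le).2 hz2
    have h0s : IntervalIntegrable (fun s => z s ^ 2) volume 0 s :=
      (intervalIntegrable_iff_integrableOn_Ioc_of_le hs.1.le).2
        (hz2.mono_set (Ioc_subset_Ioc_right hs.2))
    have h := hIoi s hs 1 measurable_one
    simp only [Pi.one_apply, mul_one, lintegral_one, Measure.restrict_apply_univ] at h
    rw [hA, hA, intervalIntegral.integral_interval_sub_left h0T h0s,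
      intervalIntegral.integral_of_le hs.2, rightTail, measureReal_def, h,
      integral_eq_lintegral_of_nonneg_ae (ae_of_all _ fun u => sq_nonneg _) (by fun_prop)]
  have hHardy := lintegral_sq_tailAverage_le μ (f := fun u => ‖f u‖ₑ) (by fun_prop)
  have hlhs : ∫⁻ s in Ioc 0 T, ENNReal.ofReal
      (((A T - A s)⁻¹ * ∫ u in s..T, f u * z u ^ 2) ^ 2 * z s ^ 2) ≤
      ∫⁻ s, ((ENNReal.ofReal (rightTail μ s))⁻¹ * ∫⁻ u in Ioi s, ‖f u‖ₑ ∂μ) ^ 2 ∂μ := by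
    rw [hμ, lintegral_withDensity_eq_lintegral_mul_non_measurable _ hwm
      (ae_of_all _ fun _ => ENNReal.ofReal_lt_top), ← hμ]
    refine setLIntegral_mono' measurableSet_Ioc fun s hs => ?_
    have hint : ‖∫ u in s..T, f u * z u ^ 2‖ₑ ≤ ∫⁻ u in Ioi s, ‖f u‖ₑ ∂μ := by
      rw [hIoi s hs _ (by fun_prop), intervalIntegral.integral_of_le hs.2]
      refine (enorm_integral_le_lintegral_enorm _).trans (le_of_eq (lintegral_congr fun u => ?_))
      rw [enorm_mul, mul_comm, Real.enorm_of_nonneg (sq_nonneg (z u))]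
    have hinv : ‖(rightTail μ s)⁻¹‖ₑ ≤ (ENNReal.ofReal (rightTail μ s))⁻¹ := by
      rcases (rightTail_nonneg μ s).eq_or_lt with h | h
      · simp [← h]
      · rw [Real.enorm_of_nonneg (by positivity), ENNReal.ofReal_inv_of_pos h]
    rw [Pi.mul_apply, mul_comm, ENNReal.ofReal_mul (sq_nonneg _), htail s hs,
      ← Real.enorm_of_nonneg (sq_nonneg (_ * _)), enorm_pow, enorm_mul]
    gcongr
  have hrhs : ∫⁻ u, ‖f u‖ₑ ^ 2 ∂μ = ENNReal.ofReal (∫ s in (0:ℝ)..T, f s ^ 2 * z s ^ 2) := by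
    rw [hμ, lintegral_withDensity_eq_lintegral_mul _ hwm (by fun_prop),
      intervalIntegral.integral_of_le hT.le, ofReal_integral_eq_lintegral_ofReal hfL2
        (ae_of_all _ fun u => by positivity)]
    refine lintegral_congr fun u => ?_
    rw [Pi.mul_apply, mul_comm, ENNReal.ofReal_mul (sq_nonneg _), ← enorm_pow,
      Real.enorm_of_nonneg (sq_nonneg _)]
  have hnn : 0 ≤ ∫ s in (0:ℝ)..T, f s ^ 2 * z s ^ 2 :=
    intervalIntegral.integral_nonneg hT.le fun u _ => by positivity
  rw [intervalIntegral.integral_of_le hT.le]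
  by_cases hI : IntegrableOn
      (fun s => ((A T - A s)⁻¹ * ∫ u in s..T, f u * z u ^ 2) ^ 2 * z s ^ 2) (Ioc 0 T)
  · rw [← ENNReal.ofReal_le_ofReal_iff (by positivity), ENNReal.ofReal_mul (by norm_num),
      ← hrhs, ENNReal.ofReal_ofNat,
      ofReal_integral_eq_lintegral_ofReal hI (ae_of_all _ fun u => by positivity)]
    exact hlhs.trans hHardy
  · rw [integral_undef hI]
    positivity
end

section
/- The operator β¹ defined by (β¹f)(s) = f(s) − ∫_s^T (f(u)/A(u)) z(u)² du maps L²_T isometrically into the mean-zero subspace L²_{T,0}: for every f ∈ L²_T one has ∫₀^T (β¹f)(s) z(s)² ds = 0 and ∫₀^T (β¹f)(s)² z(s)² ds = ∫₀^T f(s)² z(s)² ds. -/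
open MeasureTheory Set

/-- For an interval integrable `k`, the square of its tail integral `G(s) = ∫ₛᵀ k` is
`2 ∫ₛᵀ k G`. -/
theorem sq_tail_integral {s T : ℝ} {k : ℝ → ℝ} (hk : IntervalIntegrable k volume s T) :
    (∫ u in s..T, k u) ^ 2 = ∫ u in s..T, 2 * (k u * ∫ v in u..T, k v) := by
  have hac := (hk.absolutelyContinuousOnInterval_intervalIntegral (c := T) (by simp)).neg
  have h := hac.integral_deriv_mul_eq_sub hac
  have hG : ∀ u, -(∫ v in T..u, k v) = ∫ v in u..T, k v := fun u =>
    (intervalIntegral.integral_symm _ _).symm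
  simp only [Pi.neg_apply, hG, intervalIntegral.integral_same] at h
  have h2 : ∫ u in s..T, 2 * (k u * ∫ v in u..T, k v) = -(-0 * -0 -
      (∫ v in s..T, k v) * ∫ v in s..T, k v) := by
    rw [← h, ← intervalIntegral.integral_neg]
    apply intervalIntegral.integral_congr_ae
    filter_upwards [hk.ae_hasDerivAt_integral] with x hx hxI
    have hd := (hx (uIoc_subset_uIcc hxI) T (by simp)).neg.deriv
    rw [hd]
    ring
  rw [h2]
  ring

section Hardy

variable {T : ℝ} {w A p f : ℝ → ℝ}

/-- Away from `0`, dividing by a positive monotone weight preserves integrability. -/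
theorem integrableOn_div_of_monotoneOn (hA : MonotoneOn A (Ioc 0 T)) (hAm : Measurable A)
    (hApos : ∀ t ∈ Ioc 0 T, 0 < A t) (hp : IntegrableOn p (Ioc 0 T)) {s : ℝ} (hs : 0 < s) :
    IntegrableOn (fun u => p u / A u) (Ioc s T) := by
  rcases le_or_gt s T with hsT | hsT
  · have hps : IntegrableOn p (Ioc s T) := hp.mono_set (Ioc_subset_Ioc_left hs.le)
    have hAs := hApos s ⟨hs, hsT⟩
    refine (hps.norm.div_const (A s)).mono'
      (hps.aestronglyMeasurable.aemeasurable.div hAm.aemeasurable).aestronglyMeasurable ?_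
    filter_upwards [ae_restrict_mem measurableSet_Ioc] with u hu
    have hsu := hA ⟨hs, hsT⟩ ⟨hs.trans hu.1, hu.2⟩ hu.1.le
    rw [norm_div, Real.norm_of_nonneg (hAs.trans_le hsu).le]
    gcongr
  · simp [Ioc_eq_empty_of_le hsT.le]

/-- Fubini: if `A` is the primitive of `w`, then `∫₀ᵀ (∫ₛᵀ p / A) w(s) ds = ∫₀ᵀ p`. -/
theorem integral_tail_div_mul (hw : IntegrableOn w (Ioc 0 T)) (hw0 : ∀ s, 0 ≤ w s)
    (hA : ∀ t, A t = ∫ s in (0 : ℝ)..t, w s) (hAm : Measurable A)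
    (hApos : ∀ t ∈ Ioc 0 T, 0 < A t) (hp : IntegrableOn p (Ioc 0 T)) :
    IntegrableOn (fun s => (∫ u in s..T, p u / A u) * w s) (Ioc 0 T) ∧
      ∫ s in Ioc 0 T, (∫ u in s..T, p u / A u) * w s = ∫ u in Ioc 0 T, p u := by
  set μ := volume.restrict (Ioc (0 : ℝ) T) with hμ
  set F : ℝ × ℝ → ℝ := {x : ℝ × ℝ | x.1 < x.2}.indicator fun x => w x.1 * (p x.2 / A x.2) with hF
  have hsec : ∀ u, (fun s => F (s, u)) = (Iio u).indicator fun s => w s * (p u / A u) := by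
    intro u
    ext s
    simp [hF, indicator_apply]
  have hset : ∀ u ∈ Ioc 0 T, Iio u ∩ Ioc 0 T = Ioo 0 u := by
    intro u hu
    ext s
    simp only [mem_inter_iff, mem_Iio, mem_Ioc, mem_Ioo]
    exact ⟨fun h => ⟨h.2.1, h.1⟩, fun h => ⟨h.2, h.1, h.2.le.trans hu.2⟩⟩
  have hwint : ∀ u ∈ Ioc 0 T, ∀ c : ℝ,
      ∫ s, (Iio u).indicator (fun s => w s * c) s ∂μ = A u * c := by
    intro u hu c
    rw [integral_indicator measurableSet_Iio, hμ, Measure.restrict_restrict measurableSet_Iio,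
      hset u hu, integral_mul_const, hA, intervalIntegral.integral_of_le hu.1.le,
      integral_Ioc_eq_integral_Ioo]
  have hFm : AEStronglyMeasurable F (μ.prod μ) := by
    refine AEStronglyMeasurable.indicator ?_ (measurableSet_lt measurable_fst measurable_snd)
    exact (hw.aestronglyMeasurable.comp_fst).mul
      (hp.aestronglyMeasurable.aemeasurable.div hAm.aemeasurable).aestronglyMeasurable.comp_snd
  have hFi : Integrable F (μ.prod μ) := by
    rw [integrable_prod_iff' hFm]
    refine ⟨.of_forall fun u => ?_, ?_⟩
    · rw [hsec u]
      exact (hw.mul_const _).indicator measurableSet_Iio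
    · refine hp.norm.congr ?_
      filter_upwards [ae_restrict_mem measurableSet_Ioc] with u hu
      have : ∀ s, ‖F (s, u)‖ = (Iio u).indicator (fun s => w s * (‖p u‖ / A u)) s := by
        intro s
        rw [congrFun (hsec u) s, norm_indicator_eq_indicator_norm]
        congr 1
        ext s
        rw [norm_mul, norm_div, Real.norm_of_nonneg (hw0 s),
          Real.norm_of_nonneg (hApos u hu).le]
      simp only [this]
      rw [hwint u hu, mul_div_cancel₀ _ (hApos u hu).ne']
  have hleft : (fun s => ∫ u, F (s, u) ∂μ) =ᵐ[μ] fun s => (∫ u in s..T, p u / A u) * w s := by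
    filter_upwards [ae_restrict_mem measurableSet_Ioc] with s hs
    have : (fun u => F (s, u)) = (Ioi s).indicator fun u => w s * (p u / A u) := by
      ext u
      simp [hF, indicator_apply]
    have hset' : Ioi s ∩ Ioc 0 T = Ioc s T := by
      ext u
      simp only [mem_inter_iff, mem_Ioi, mem_Ioc]
      exact ⟨fun h => ⟨h.1, h.2.2⟩, fun h => ⟨h.1, hs.1.trans h.1, h.2⟩⟩
    rw [this, integral_indicator measurableSet_Ioi, hμ,
      Measure.restrict_restrict measurableSet_Ioi, hset', integral_const_mul,
      intervalIntegral.integral_of_le hs.2, mul_comm]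
  refine ⟨hFi.integral_prod_left.congr hleft, ?_⟩
  rw [← integral_congr_ae hleft, integral_integral_swap (f := fun s u => F (s, u)) hFi]
  refine integral_congr_ae ?_
  filter_upwards [ae_restrict_mem measurableSet_Ioc] with u hu
  simp only [congrFun (hsec u)]
  rw [hwint u hu, mul_div_cancel₀ _ (hApos u hu).ne']

/-- With `G(s) = ∫ₛᵀ p / A`, integrability of `p G` yields `∫₀ᵀ G² w = 2 ∫₀ᵀ p G`. -/
theorem integral_sq_tail_div_mul (hw : IntegrableOn w (Ioc 0 T)) (hw0 : ∀ s, 0 ≤ w s)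
    (hA : ∀ t, A t = ∫ s in (0 : ℝ)..t, w s) (hAm : Measurable A)
    (hAmono : MonotoneOn A (Ioc 0 T)) (hApos : ∀ t ∈ Ioc 0 T, 0 < A t)
    (hp : IntegrableOn p (Ioc 0 T))
    (hpG : IntegrableOn (fun u => p u * ∫ v in u..T, p v / A v) (Ioc 0 T)) :
    IntegrableOn (fun s => (∫ u in s..T, p u / A u) ^ 2 * w s) (Ioc 0 T) ∧
      ∫ s in Ioc 0 T, (∫ u in s..T, p u / A u) ^ 2 * w s =
        2 * ∫ u in Ioc 0 T, p u * ∫ v in u..T, p v / A v := by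
  have h := integral_tail_div_mul hw hw0 hA hAm hApos (hpG.const_mul 2)
  have hsq : EqOn (fun s => (∫ u in s..T, 2 * (p u * ∫ v in u..T, p v / A v) / A u) * w s)
      (fun s => (∫ u in s..T, p u / A u) ^ 2 * w s) (Ioc 0 T) := by
    intro s hs
    have hk := integrableOn_div_of_monotoneOn hAmono hAm hApos hp hs.1
    simp only
    rw [sq_tail_integral ((intervalIntegrable_iff_integrableOn_Ioc_of_le hs.2).2 hk)]
    congr 2
    ext u
    ring
  refine ⟨h.1.congr_fun hsq measurableSet_Ioc, ?_⟩
  rw [← setIntegral_congr_fun measurableSet_Ioc hsq, h.2, integral_const_mul]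

theorem integrableOn_mul_mul_of_sq {g : ℝ → ℝ} {S : Set ℝ} (hw0 : ∀ s, 0 ≤ w s)
    (hm : AEStronglyMeasurable (fun s => f s * g s * w s) (volume.restrict S))
    (hf : IntegrableOn (fun s => f s ^ 2 * w s) S) (hg : IntegrableOn (fun s => g s ^ 2 * w s) S) :
    IntegrableOn (fun s => f s * g s * w s) S := by
  refine (hf.add hg).mono' hm (.of_forall fun s => ?_)
  rw [norm_mul, norm_mul, Real.norm_of_nonneg (hw0 s), Real.norm_eq_abs, Real.norm_eq_abs]
  have : |f s| * |g s| ≤ f s ^ 2 + g s ^ 2 := by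
    nlinarith [sq_abs (f s), sq_abs (g s), sq_nonneg (|f s| - |g s|), sq_nonneg (f s),
      sq_nonneg (g s)]
  calc _ ≤ (f s ^ 2 + g s ^ 2) * w s := mul_le_mul_of_nonneg_right this (hw0 s)
    _ = _ := by simp only [Pi.add_apply]; ring

/-- Hardy's inequality, in the form of the square integrability of `∫ₛᵀ (f w) / A`. -/
theorem integrableOn_sq_tail_div_mul (hT : 0 < T) (hwm : Measurable w)
    (hw : IntegrableOn w (Ioc 0 T)) (hw0 : ∀ s, 0 ≤ w s)
    (hA : ∀ t, A t = ∫ s in (0 : ℝ)..t, w s) (hAm : Measurable A)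
    (hAmono : MonotoneOn A (Ioc 0 T)) (hApos : ∀ t ∈ Ioc 0 T, 0 < A t)
    (hfm : Measurable f) (hf : IntegrableOn (fun s => f s ^ 2 * w s) (Ioc 0 T)) :
    IntegrableOn (fun s => (∫ u in s..T, f u * w u / A u) ^ 2 * w s) (Ioc 0 T) := by
  have hfw : IntegrableOn (fun s => f s * w s) (Ioc 0 T) := by
    simpa using integrableOn_mul_mul_of_sq (g := fun _ => 1) hw0
      ((hfm.mul measurable_const).mul hwm).aestronglyMeasurable hf (by simpa using hw)
  have key : ∀ ε ∈ Ioc 0 T,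
      IntegrableOn (fun s => (∫ u in s..T, f u * w u / A u) ^ 2 * w s) (Ioc ε T) ∧
      ∫ s in Ioc ε T, (∫ u in s..T, f u * w u / A u) ^ 2 * w s ≤
        4 * ∫ s in Ioc 0 T, f s ^ 2 * w s := by
    intro ε hε
    set g : ℝ → ℝ := (Ioi ε).indicator f with hg
    have hgw : (fun s => g s * w s) = (Ioi ε).indicator fun s => f s * w s := by
      ext s
      simp [hg, indicator_apply]
    have hgwA : (fun s => g s * w s / A s) = (Ioi ε).indicator fun s => f s * w s / A s := by
      ext s
      by_cases h : ε < s <;> simp [hg, h]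
    have hg2 : (fun s => g s ^ 2 * w s) = (Ioi ε).indicator fun s => f s ^ 2 * w s := by
      ext s
      by_cases h : ε < s <;> simp [hg, h]
    have hgi : IntegrableOn (fun s => g s * w s) (Ioc 0 T) := by
      rw [hgw]
      exact Integrable.indicator hfw measurableSet_Ioi
    have hg2i : IntegrableOn (fun s => g s ^ 2 * w s) (Ioc 0 T) := by
      rw [hg2]
      exact Integrable.indicator hf measurableSet_Ioi
    have hki : IntegrableOn (fun s => g s * w s / A s) (Icc 0 T) := by
      rw [integrableOn_Icc_iff_integrableOn_Ioc, hgwA, IntegrableOn,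
        integrable_indicator_iff measurableSet_Ioi, IntegrableOn,
        Measure.restrict_restrict measurableSet_Ioi]
      exact (integrableOn_div_of_monotoneOn hAmono hAm hApos hfw hε.1).mono_set
        fun s hs => ⟨hs.1, hs.2.2⟩
    set G : ℝ → ℝ := fun s => ∫ u in s..T, g u * w u / A u with hG
    have hGc : ContinuousOn G (Icc 0 T) := by
      have := intervalIntegral.continuousOn_primitive_interval_left (μ := volume)
        (f := fun s => g s * w s / A s) (a := 0) (b := T) (by rwa [uIcc_of_le hT.le])
      rwa [uIcc_of_le hT.le] at this
    have hgG : IntegrableOn (fun u => g u * w u * G u) (Ioc 0 T) := by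
      rw [← integrableOn_Icc_iff_integrableOn_Ioc] at hgi ⊢
      exact hgi.mul_continuousOn hGc isCompact_Icc
    obtain ⟨hG2i, hG2⟩ := integral_sq_tail_div_mul hw hw0 hA hAm hAmono hApos hgi hgG
    have hbound : 2 * ∫ u in Ioc 0 T, g u * w u * G u ≤
        2 * (∫ s in Ioc 0 T, g s ^ 2 * w s) + (1 / 2) * ∫ s in Ioc 0 T, G s ^ 2 * w s := by
      rw [← integral_const_mul, ← integral_const_mul, ← integral_const_mul,
        ← integral_add (hg2i.const_mul 2) (hG2i.const_mul (1 / 2))]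
      refine integral_mono (hgG.const_mul 2) ((hg2i.const_mul 2).add (hG2i.const_mul (1 / 2)))
        fun s => ?_
      nlinarith [mul_nonneg (hw0 s) (sq_nonneg (2 * g s - G s))]
    have hgf : ∫ s in Ioc 0 T, g s ^ 2 * w s ≤ ∫ s in Ioc 0 T, f s ^ 2 * w s := by
      refine integral_mono hg2i hf fun s => ?_
      rw [congrFun hg2 s]
      exact indicator_le_self' (fun _ _ => mul_nonneg (sq_nonneg _) (hw0 _)) s
    have hGeq : EqOn (fun s => G s ^ 2 * w s)
        (fun s => (∫ u in s..T, f u * w u / A u) ^ 2 * w s) (Ioc ε T) := by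
      intro s hs
      have : G s = ∫ u in s..T, f u * w u / A u := by
        refine intervalIntegral.integral_congr_ae (.of_forall fun u hu => ?_)
        rw [uIoc_of_le hs.2] at hu
        rw [congrFun hgwA u, indicator_of_mem (mem_Ioi.2 (hs.1.trans hu.1))]
      simp only [this]
    have hsub : Ioc ε T ⊆ Ioc 0 T := Ioc_subset_Ioc_left hε.1.le
    refine ⟨(hG2i.mono_set hsub).congr_fun hGeq measurableSet_Ioc, ?_⟩
    rw [← setIntegral_congr_fun measurableSet_Ioc hGeq]
    have hmono : ∫ s in Ioc ε T, G s ^ 2 * w s ≤ ∫ s in Ioc 0 T, G s ^ 2 * w s :=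
      setIntegral_mono_set hG2i (.of_forall fun s => mul_nonneg (sq_nonneg _) (hw0 s))
        hsub.eventuallyLE
    linarith
  have hmem : ∀ n : ℕ, T / (n + 1) ∈ Ioc 0 T := fun n =>
    ⟨by positivity, div_le_self hT.le (by simp)⟩
  refine integrableOn_Ioc_of_intervalIntegral_norm_bounded_left (l := Filter.atTop)
    (a := fun n : ℕ => T / (n + 1)) (I := 4 * ∫ s in Ioc 0 T, f s ^ 2 * w s)
    (fun n => (key _ (hmem n)).1) ?_ (.of_forall fun n => ?_)
  · simpa [div_eq_mul_inv] using (tendsto_one_div_add_atTop_nhds_zero_nat (𝕜 := ℝ)).const_mul T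
  · simpa only [Real.norm_of_nonneg (mul_nonneg (sq_nonneg _) (hw0 _))] using (key _ (hmem n)).2

end Hardy

/-- The operator `(β¹ f)(s) = f(s) − ∫ₛᵀ (f(u)/A(u)) z(u)² du` maps `L²([0,T], z² ds)`
isometrically into the mean-zero subspace `L²_{T,0}`. -/
theorem beta1_isometry_into_mean_zero
    (T : ℝ) (hT : 0 < T)
    (z : ℝ → ℝ) (hz : Measurable z)
    (hz2 : IntegrableOn (fun s => z s ^ 2) (Set.Ioc 0 T))
    (hzne : ∀ᵐ s ∂(volume.restrict (Set.Ioc 0 T)), z s ≠ 0)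
    (A : ℝ → ℝ) (hA : ∀ t, A t = ∫ s in (0:ℝ)..t, z s ^ 2)
    (f : ℝ → ℝ) (hf : Measurable f)
    (hfL2 : IntegrableOn (fun s => f s ^ 2 * z s ^ 2) (Set.Ioc 0 T)) :
    (∫ s in (0:ℝ)..T, (f s - ∫ u in s..T, (f u / A u) * z u ^ 2) * z s ^ 2) = 0
    ∧ (∫ s in (0:ℝ)..T, (f s - ∫ u in s..T, (f u / A u) * z u ^ 2) ^ 2 * z s ^ 2)
        = ∫ s in (0:ℝ)..T, f s ^ 2 * z s ^ 2 := by
  have hw0 : ∀ s, 0 ≤ z s ^ 2 := fun s => sq_nonneg _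
  have hint : ∀ t ∈ Icc 0 T, IntervalIntegrable (fun s => z s ^ 2) volume 0 t := fun t ht =>
    (intervalIntegrable_iff_integrableOn_Ioc_of_le ht.1).2
      (hz2.mono_set (Ioc_subset_Ioc_right ht.2))
  have hAm : Measurable A := by
    have h : A = fun t => (∫ s in Ioc 0 t, z s ^ 2) - ∫ s in Ioc t 0, z s ^ 2 := by
      ext t
      rw [hA, intervalIntegral]
    have hmeas : ∀ S : Set (ℝ × ℝ), MeasurableSet S →
        Measurable fun t => ∫ s, S.indicator (fun x => z x.2 ^ 2) (t, s) := fun S hS =>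
      (StronglyMeasurable.integral_prod_right (f := fun t s => S.indicator
        (fun x : ℝ × ℝ => z x.2 ^ 2) (t, s)) (((hz.comp measurable_snd).pow_const 2).indicator
        hS).stronglyMeasurable).measurable
    rw [h]
    refine Measurable.sub ?_ ?_
    · convert hmeas {x | 0 < x.2 ∧ x.2 ≤ x.1}
        ((measurableSet_lt measurable_const measurable_snd).inter
          (measurableSet_le measurable_snd measurable_fst)) using 2 with t
      rw [← integral_indicator measurableSet_Ioc]
      rfl
    · convert hmeas {x | x.1 < x.2 ∧ x.2 ≤ 0}
        ((measurableSet_lt measurable_fst measurable_snd).inter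
          (measurableSet_le measurable_snd measurable_const)) using 2 with t
      rw [← integral_indicator measurableSet_Ioc]
      rfl
  have hAmono : MonotoneOn A (Ioc 0 T) := by
    intro a ha b hb hab
    rw [hA, hA]
    exact intervalIntegral.integral_mono_interval le_rfl ha.1.le hab (.of_forall hw0)
      (hint b ⟨hb.1.le, hb.2⟩)
  have hApos : ∀ t ∈ Ioc 0 T, 0 < A t := by
    intro t ht
    rw [hA, intervalIntegral.integral_pos_iff_support_of_nonneg_ae (.of_forall hw0)
      (hint t ⟨ht.1.le, ht.2⟩)]
    refine ⟨ht.1, ?_⟩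
    have hae : ∀ᵐ s ∂(volume.restrict (Ioc 0 t)), s ∈ Function.support fun s => z s ^ 2 := by
      filter_upwards [ae_restrict_of_ae_restrict_of_subset (Ioc_subset_Ioc_right ht.2) hzne]
        with s hs
      exact pow_ne_zero 2 hs
    have hmeas : volume (Function.support (fun s => z s ^ 2) ∩ Ioc 0 t) = volume (Ioc 0 t) := by
      rw [← Measure.restrict_apply' measurableSet_Ioc, ← Measure.restrict_apply_univ (Ioc 0 t)]
      exact measure_congr (Filter.eventuallyEq_univ.2 hae)
    rw [hmeas]
    simpa using ht.1
  have hk : ∀ s, ∫ u in s..T, f u / A u * z u ^ 2 = ∫ u in s..T, f u * z u ^ 2 / A u := by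
    intro s
    congr 1
    ext u
    ring
  have hfw : IntegrableOn (fun s => f s * z s ^ 2) (Ioc 0 T) := by
    simpa using integrableOn_mul_mul_of_sq (g := fun _ => 1) hw0
      ((hf.mul measurable_const).mul (hz.pow_const 2)).aestronglyMeasurable hfL2
      (by simpa using hz2)
  simp only [hk, intervalIntegral.integral_of_le hT.le]
  set G : ℝ → ℝ := fun s => ∫ u in s..T, f u * z u ^ 2 / A u with hG
  obtain ⟨hGi, hGint⟩ := integral_tail_div_mul hz2 hw0 hA hAm hApos hfw
  refine ⟨?_, ?_⟩
  · simp only [sub_mul]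
    rw [integral_sub hfw hGi, hGint, sub_self]
  · have hG2 := integrableOn_sq_tail_div_mul hT (hz.pow_const 2) hz2 hw0 hA hAm hAmono hApos
      hf hfL2
    change IntegrableOn (fun s => G s ^ 2 * z s ^ 2) (Ioc 0 T) at hG2
    have hfG : IntegrableOn (fun s => f s * z s ^ 2 * G s) (Ioc 0 T) := by
      have hm : AEStronglyMeasurable (fun s => f s * G s * z s ^ 2)
          (volume.restrict (Ioc 0 T)) := by
        convert hf.aestronglyMeasurable.mul hGi.aestronglyMeasurable using 2 with s
        simp only [Pi.mul_apply, hG]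
        ring
      refine (integrableOn_mul_mul_of_sq hw0 hm hfL2 hG2).congr_fun (fun s _ => ?_)
        measurableSet_Ioc
      ring
    have hsq := (integral_sq_tail_div_mul hz2 hw0 hA hAm hAmono hApos hfw hfG).2
    change ∫ s in Ioc 0 T, G s ^ 2 * z s ^ 2 = 2 * ∫ s in Ioc 0 T, f s * z s ^ 2 * G s at hsq
    have hexp : ∀ s, (f s - G s) ^ 2 * z s ^ 2 =
        f s ^ 2 * z s ^ 2 - 2 * (f s * z s ^ 2 * G s) + G s ^ 2 * z s ^ 2 := fun s => by ring
    change ∫ s in Ioc 0 T, (f s - G s) ^ 2 * z s ^ 2 = _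
    simp only [hexp]
    have hcross : IntegrableOn (fun s => f s ^ 2 * z s ^ 2 - 2 * (f s * z s ^ 2 * G s)) (Ioc 0 T) :=
      hfL2.sub (hfG.const_mul 2)
    rw [integral_add hcross hG2, integral_sub hfL2 (hfG.const_mul 2), integral_const_mul, hsq]
    ring
end

section
/- The operator α¹ defined by (α¹f)(s) = f(s) − A(s)⁻¹ ∫₀^s f(u) z(u)² du is an isometry on the mean-zero subspace: for every f ∈ L²_T with ∫₀^T f(s) z(s)² ds = 0 one has ∫₀^T (α¹f)(s)² z(s)² ds = ∫₀^T f(s)² z(s)² ds. -/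
open MeasureTheory Set

/-- The reciprocal of an absolutely continuous function bounded below by a positive constant is
absolutely continuous. -/
theorem AbsolutelyContinuousOnInterval.inv_of_le {f : ℝ → ℝ} {a b c : ℝ}
    (hf : AbsolutelyContinuousOnInterval f a b) (hc : 0 < c) (hcf : ∀ x ∈ uIcc a b, c ≤ f x) :
    AbsolutelyContinuousOnInterval (fun x => (f x)⁻¹) a b := by
  rw [absolutelyContinuousOnInterval_iff] at hf ⊢
  intro ε hε
  obtain ⟨δ, hδ, h⟩ := hf (ε * c ^ 2) (by positivity)
  refine ⟨δ, hδ, fun E hE hEδ => ?_⟩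
  have hsum := h E hE hEδ
  have hle : ∑ i ∈ Finset.range E.1, dist (f (E.2 i).1)⁻¹ (f (E.2 i).2)⁻¹
      ≤ (∑ i ∈ Finset.range E.1, dist (f (E.2 i).1) (f (E.2 i).2)) / c ^ 2 := by
    rw [Finset.sum_div]
    refine Finset.sum_le_sum fun i hi => ?_
    have h1 := hcf _ (hE.1 i hi).1
    have h2 := hcf _ (hE.1 i hi).2
    have h1' := hc.trans_le h1
    have h2' := hc.trans_le h2
    rw [dist_inv_inv₀ h1'.ne' h2'.ne', Real.norm_of_nonneg h1'.le, Real.norm_of_nonneg h2'.le, sq]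
    gcongr
  refine hle.trans_lt ?_
  rwa [div_lt_iff₀ (by positivity)]

/-- The primitive of a nonnegative, almost everywhere nonzero function is positive. -/
theorem integral_pos_of_ae_ne_zero {w : ℝ → ℝ} {T t : ℝ} (hw0 : ∀ s, 0 ≤ w s)
    (hw : IntervalIntegrable w volume 0 T) (hwne : ∀ᵐ s ∂(volume.restrict (Ioc 0 T)), w s ≠ 0)
    (ht : t ∈ Ioc 0 T) : 0 < ∫ s in (0:ℝ)..t, w s := by
  have hwt : IntervalIntegrable w volume 0 t :=
    hw.mono_set (by
      rw [uIcc_of_le ht.1.le, uIcc_of_le (ht.1.le.trans ht.2)]; exact Icc_subset_Icc_right ht.2)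
  refine (intervalIntegral.integral_nonneg ht.1.le fun s _ => hw0 s).lt_of_ne fun h => ?_
  have h' := (intervalIntegral.integral_eq_zero_iff_of_le_of_nonneg_ae ht.1.le
    (.of_forall hw0) hwt).1 h.symm
  have hne := ae_restrict_of_ae_restrict_of_subset (Ioc_subset_Ioc_right ht.2) hwne
  have hfalse : ∀ᵐ s ∂(volume.restrict (Ioc 0 t)), False := by
    filter_upwards [h', hne] with s h1 h2 using h2 h1
  rw [Filter.eventually_false_iff_eq_bot, ae_eq_bot, Measure.restrict_eq_zero,
    Real.volume_Ioc] at hfalse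
  simp [ht.1.not_ge] at hfalse

/-- Cauchy–Schwarz inequality for the pairing of `f` with `1` in a weighted `L²` space. -/
theorem sq_integral_mul_weight_le {w f : ℝ → ℝ} {a b : ℝ} (hab : a ≤ b) (hw0 : ∀ s, 0 ≤ w s)
    (hw : IntervalIntegrable w volume a b)
    (hfw : IntervalIntegrable (fun s => f s * w s) volume a b)
    (hf2 : IntervalIntegrable (fun s => f s ^ 2 * w s) volume a b) :
    (∫ s in a..b, f s * w s) ^ 2 ≤ (∫ s in a..b, f s ^ 2 * w s) * ∫ s in a..b, w s := by
  have key : discrim (∫ s in a..b, f s ^ 2 * w s) (2 * ∫ s in a..b, f s * w s)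
      (∫ s in a..b, w s) ≤ 0 := by
    refine discrim_le_zero fun x => ?_
    have hexp : ∫ s in a..b, (x * f s + 1) ^ 2 * w s = (∫ s in a..b, f s ^ 2 * w s) * (x * x) +
        (2 * ∫ s in a..b, f s * w s) * x + ∫ s in a..b, w s := by
      rw [← intervalIntegral.integral_const_mul, ← intervalIntegral.integral_mul_const,
        ← intervalIntegral.integral_mul_const,
        ← intervalIntegral.integral_add (hf2.mul_const _) ((hfw.const_mul _).mul_const _),
        ← intervalIntegral.integral_add ((hf2.mul_const _).add ((hfw.const_mul _).mul_const _)) hw]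
      exact intervalIntegral.integral_congr fun s _ => by ring
    rw [← hexp]
    exact intervalIntegral.integral_nonneg hab fun s _ => mul_nonneg (sq_nonneg _) (hw0 s)
  unfold discrim at key
  nlinarith

/-- Away from the origin, the weighted square of the Hardy-type difference operator integrates to
the weighted square of `f`, up to boundary terms. -/
theorem integral_sub_average_sq {w f : ℝ → ℝ} {T ε : ℝ} (hε : ε ∈ Ioc 0 T) (hw0 : ∀ s, 0 ≤ w s)
    (hw : IntervalIntegrable w volume 0 T)
    (hfw : IntervalIntegrable (fun s => f s * w s) volume 0 T)
    (hf2 : IntervalIntegrable (fun s => f s ^ 2 * w s) volume 0 T)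
    (hpos : 0 < ∫ u in (0:ℝ)..ε, w u) :
    IntervalIntegrable (fun s => (f s - (∫ u in (0:ℝ)..s, w u)⁻¹ *
      ∫ u in (0:ℝ)..s, f u * w u) ^ 2 * w s) volume ε T ∧
    ∫ s in ε..T, (f s - (∫ u in (0:ℝ)..s, w u)⁻¹ * ∫ u in (0:ℝ)..s, f u * w u) ^ 2 * w s =
      (∫ s in ε..T, f s ^ 2 * w s) +
        (∫ u in (0:ℝ)..ε, f u * w u) ^ 2 * (∫ u in (0:ℝ)..ε, w u)⁻¹ -
        (∫ u in (0:ℝ)..T, f u * w u) ^ 2 * (∫ u in (0:ℝ)..T, w u)⁻¹ := by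
  have hT : 0 ≤ T := hε.1.le.trans hε.2
  have hsub : uIcc ε T ⊆ uIcc 0 T := by
    rw [uIcc_of_le hε.2, uIcc_of_le hT]; exact Icc_subset_Icc_left hε.1.le
  set A : ℝ → ℝ := fun t => ∫ u in (0:ℝ)..t, w u with hA
  set F : ℝ → ℝ := fun t => ∫ u in (0:ℝ)..t, f u * w u with hF
  have hAle : ∀ x ∈ uIcc ε T, A ε ≤ A x := fun x hx => by
    have hx' := hsub hx
    rw [uIcc_of_le hε.2] at hx
    refine intervalIntegral.integral_mono_interval le_rfl hε.1.le hx.1 (.of_forall hw0)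
      (hw.mono_set (uIcc_subset_uIcc_left hx'))
  have hAac : AbsolutelyContinuousOnInterval A ε T :=
    (hw.absolutelyContinuousOnInterval_intervalIntegral (by simp)).mono hsub
  have hFac : AbsolutelyContinuousOnInterval F ε T :=
    (hfw.absolutelyContinuousOnInterval_intervalIntegral (by simp)).mono hsub
  have hG := (hFac.fun_mul hFac).fun_mul (hAac.inv_of_le hpos hAle)
  set G : ℝ → ℝ := fun x => F x * F x * (A x)⁻¹ with hGdef
  have hf2' := hf2.mono_set hsub
  have hae : ∀ᵐ x, x ∈ uIoc ε T →
      f x ^ 2 * w x - deriv G x = (f x - (A x)⁻¹ * F x) ^ 2 * w x := by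
    filter_upwards [hw.ae_hasDerivAt_integral, hfw.ae_hasDerivAt_integral] with x h1 h2 hx
    have hx' := uIoc_subset_uIcc hx
    have dA : HasDerivAt A (w x) x := h1 (hsub hx') 0 (by simp)
    have dF : HasDerivAt F (f x * w x) x := h2 (hsub hx') 0 (by simp)
    have hne : A x ≠ 0 := (hpos.trans_le (hAle x hx')).ne'
    have dG : HasDerivAt G _ x := (dF.mul dF).mul (dA.inv hne)
    rw [dG.deriv]
    simp only [Pi.mul_apply]
    field_simp
    ring
  have hint := hf2'.sub hG.intervalIntegrable_deriv
  refine ⟨hint.congr_ae ((ae_restrict_iff' measurableSet_uIoc).2 hae), ?_⟩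
  rw [← intervalIntegral.integral_congr_ae hae,
    intervalIntegral.integral_sub hf2' hG.intervalIntegrable_deriv, hG.integral_deriv_eq_sub]
  simp only [hGdef]
  ring

/-- Isometry property of `f ↦ f - A⁻¹ ∫₀ f w` for a general weight `w` with primitive `A`. -/
theorem integral_sub_average_sq_eq {w f : ℝ → ℝ} {T : ℝ} (hT : 0 < T) (hw0 : ∀ s, 0 ≤ w s)
    (hw : IntervalIntegrable w volume 0 T)
    (hwne : ∀ᵐ s ∂(volume.restrict (Ioc 0 T)), w s ≠ 0)
    (hfw : IntervalIntegrable (fun s => f s * w s) volume 0 T)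
    (hf2 : IntervalIntegrable (fun s => f s ^ 2 * w s) volume 0 T)
    (hf0 : ∫ s in (0:ℝ)..T, f s * w s = 0) :
    ∫ s in (0:ℝ)..T, (f s - (∫ u in (0:ℝ)..s, w u)⁻¹ * ∫ u in (0:ℝ)..s, f u * w u) ^ 2 * w s =
      ∫ s in (0:ℝ)..T, f s ^ 2 * w s := by
  set g : ℝ → ℝ := fun s =>
    (f s - (∫ u in (0:ℝ)..s, w u)⁻¹ * ∫ u in (0:ℝ)..s, f u * w u) ^ 2 * w s with hg
  set P : ℝ → ℝ := fun t => ∫ s in (0:ℝ)..t, f s ^ 2 * w s with hP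
  have hg0 : ∀ s, 0 ≤ g s := fun s => mul_nonneg (sq_nonneg _) (hw0 s)
  have key : ∀ ε ∈ Ioc 0 T, IntervalIntegrable g volume ε T ∧
      P T - P ε ≤ ∫ s in ε..T, g s ∧ ∫ s in ε..T, g s ≤ P T := by
    intro ε hε
    have hmem : ε ∈ uIcc 0 T := by rw [uIcc_of_le hT.le]; exact Ioc_subset_Icc_self hε
    have hl := uIcc_subset_uIcc_left hmem
    have hpos := integral_pos_of_ae_ne_zero hw0 hw hwne hε
    obtain ⟨hi, he⟩ := integral_sub_average_sq hε hw0 hw hfw hf2 hpos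
    have hcs := sq_integral_mul_weight_le hε.1.le hw0 (hw.mono_set hl) (hfw.mono_set hl)
      (hf2.mono_set hl)
    rw [hf0, ← div_eq_mul_inv] at he
    have hle := (div_le_iff₀ hpos).2 hcs
    have hnn := div_nonneg (sq_nonneg (∫ u in (0:ℝ)..ε, f u * w u)) hpos.le
    have hadd : P ε + ∫ s in ε..T, f s ^ 2 * w s = P T :=
      intervalIntegral.integral_add_adjacent_intervals (hf2.mono_set hl)
        (hf2.mono_set (uIcc_subset_uIcc_right hmem))
    refine ⟨hi, ?_, ?_⟩
    · rw [he]; linarith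
    · rw [he]; change _ ≤ P ε at hle; linarith
  set a : ℕ → ℝ := fun n => T * (1 / ((n : ℝ) + 1)) with ha
  have ha_mem : ∀ n, a n ∈ Ioc 0 T := fun n => by
    refine ⟨by positivity, mul_le_of_le_one_right hT.le ?_⟩
    rw [div_le_one (by positivity)]
    linarith [Nat.cast_nonneg (α := ℝ) n]
  have ha_lim : Filter.Tendsto a Filter.atTop (nhds 0) := by
    simpa [ha] using tendsto_one_div_add_atTop_nhds_zero_nat.const_mul T
  have ha_lim' : Filter.Tendsto a Filter.atTop (nhdsWithin 0 (Icc 0 T)) :=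
    tendsto_nhdsWithin_iff.2 ⟨ha_lim, .of_forall fun n => Ioc_subset_Icc_self (ha_mem n)⟩
  have hgint : IntervalIntegrable g volume 0 T := by
    rw [intervalIntegrable_iff_integrableOn_Ioc_of_le hT.le]
    refine integrableOn_Ioc_of_intervalIntegral_norm_bounded_left (I := P T) (a := a)
      (l := Filter.atTop) (fun n => ?_) ha_lim (.of_forall fun n => ?_)
    · exact (intervalIntegrable_iff_integrableOn_Ioc_of_le (ha_mem n).2).1 (key _ (ha_mem n)).1
    · simp only [Real.norm_of_nonneg (hg0 _)]
      rw [← intervalIntegral.integral_of_le (ha_mem n).2]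
      exact (key _ (ha_mem n)).2.2
  have hprim : ∀ {h : ℝ → ℝ}, IntervalIntegrable h volume 0 T →
      Filter.Tendsto (fun n => ∫ s in (0:ℝ)..a n, h s) Filter.atTop (nhds 0) := by
    intro h hh
    have hc := intervalIntegral.continuousOn_primitive_interval' hh (left_mem_uIcc)
    rw [uIcc_of_le hT.le] at hc
    simpa [Function.comp_def] using (hc 0 ⟨le_rfl, hT.le⟩).tendsto.comp ha_lim'
  have hlim1 : Filter.Tendsto (fun n => ∫ s in a n..T, g s) Filter.atTop
      (nhds (∫ s in (0:ℝ)..T, g s)) := by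
    have h := (hprim hgint).const_sub (∫ s in (0:ℝ)..T, g s)
    rw [sub_zero] at h
    refine h.congr fun n => ?_
    have hmem : a n ∈ uIcc 0 T := by rw [uIcc_of_le hT.le]; exact Ioc_subset_Icc_self (ha_mem n)
    rw [← intervalIntegral.integral_add_adjacent_intervals
      (hgint.mono_set (uIcc_subset_uIcc_left hmem)) (key _ (ha_mem n)).1]
    ring
  have hlim2 : Filter.Tendsto (fun n => ∫ s in a n..T, g s) Filter.atTop (nhds (P T)) := by
    refine tendsto_of_tendsto_of_tendsto_of_le_of_le ?_ tendsto_const_nhds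
      (fun n => (key _ (ha_mem n)).2.1) (fun n => (key _ (ha_mem n)).2.2)
    simpa using (hprim hf2).const_sub (P T)
  exact tendsto_nhds_unique hlim1 hlim2

/-- The operator `(α¹ f)(s) = f(s) − A(s)⁻¹ ∫₀ˢ f(u) z(u)² du` is an isometry on the
mean-zero subspace of `L²([0,T], z² ds)`. -/
theorem alpha1_isometry_on_mean_zero
    (T : ℝ) (hT : 0 < T)
    (z : ℝ → ℝ) (hz : Measurable z)
    (hz2 : IntegrableOn (fun s => z s ^ 2) (Set.Ioc 0 T))
    (hzne : ∀ᵐ s ∂(volume.restrict (Set.Ioc 0 T)), z s ≠ 0)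
    (A : ℝ → ℝ) (hA : ∀ t, A t = ∫ s in (0:ℝ)..t, z s ^ 2)
    (f : ℝ → ℝ) (hf : Measurable f)
    (hfL2 : IntegrableOn (fun s => f s ^ 2 * z s ^ 2) (Set.Ioc 0 T))
    (hf0 : (∫ s in (0:ℝ)..T, f s * z s ^ 2) = 0) :
    (∫ s in (0:ℝ)..T, (f s - (A s)⁻¹ * ∫ u in (0:ℝ)..s, f u * z u ^ 2) ^ 2 * z s ^ 2)
      = ∫ s in (0:ℝ)..T, f s ^ 2 * z s ^ 2 := by
  have hfw : IntegrableOn (fun s => f s * z s ^ 2) (Ioc 0 T) := by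
    refine (hfL2.add hz2).mono' (hf.mul (hz.pow_const 2)).aestronglyMeasurable
      (.of_forall fun s => ?_)
    rw [norm_mul, Real.norm_of_nonneg (sq_nonneg (z s)), Real.norm_eq_abs]
    simp only [Pi.add_apply]
    nlinarith [sq_nonneg (z s), sq_nonneg (|f s| - 1), sq_abs (f s), abs_nonneg (f s)]
  simp only [hA]
  exact integral_sub_average_sq_eq (w := fun s => z s ^ 2) hT (fun s => sq_nonneg _)
    ((intervalIntegrable_iff_integrableOn_Ioc_of_le hT.le).2 hz2)
    (hzne.mono fun s hs => pow_ne_zero 2 hs)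
    ((intervalIntegrable_iff_integrableOn_Ioc_of_le hT.le).2 hfw)
    ((intervalIntegrable_iff_integrableOn_Ioc_of_le hT.le).2 hfL2) hf0
end

section
/- The operator α¹ is a left inverse of β¹ on L²_T: for every f ∈ L²_T, (α¹(β¹f))(s) = f(s) for almost every s ∈ (0,T), where (α¹g)(s) = g(s) − A(s)⁻¹ ∫₀^s g(u) z(u)² du and (β¹f)(s) = f(s) − ∫_s^T (f(u)/A(u)) z(u)² du. -/
open MeasureTheory Set

/-- Fubini on the triangle `a < u < v ≤ b` for a product `w u * h v`, where `h` itself need not be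
integrable: it suffices that `h v * ∫ₐᵛ |w|` is. -/
lemma integrableOn_and_integral_triangle {a b : ℝ} (hab : a ≤ b) {w h : ℝ → ℝ}
    (hw : IntegrableOn w (Ioc a b))
    (hh : AEStronglyMeasurable h (volume.restrict (Ioc a b)))
    (hint : IntegrableOn (fun v => |h v| * ∫ u in a..v, |w u|) (Ioc a b)) :
    IntegrableOn (fun u => (∫ v in u..b, h v) * w u) (Ioc a b) ∧
      ∫ u in a..b, (∫ v in u..b, h v) * w u = ∫ v in a..b, h v * ∫ u in a..v, w u := by
  set μ := volume.restrict (Ioc a b) with hμ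
  set G : ℝ × ℝ → ℝ := {p : ℝ × ℝ | p.1 < p.2}.indicator (fun p => w p.1 * h p.2) with hG
  have hS : MeasurableSet {p : ℝ × ℝ | p.1 < p.2} := measurableSet_lt measurable_fst measurable_snd
  have hGm : AEStronglyMeasurable G (μ.prod μ) :=
    (hw.aestronglyMeasurable.comp_fst.mul hh.comp_snd).indicator hS
  have slice_left : ∀ v, (fun u => G (u, v)) = (Iio v).indicator (fun u => w u * h v) := by
    intro v; ext u; simp [hG, indicator]
  have slice_right : ∀ u, (fun v => G (u, v)) = (Ioi u).indicator (fun v => w u * h v) := by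
    intro u; ext v; simp [hG, indicator]
  have integral_left : ∀ (k : ℝ → ℝ) (v), v ∈ Ioc a b →
      ∫ u, (Iio v).indicator k u ∂μ = ∫ u in a..v, k u := by
    intro k v hv
    rw [integral_indicator measurableSet_Iio, hμ, Measure.restrict_restrict measurableSet_Iio,
      intervalIntegral.integral_of_le hv.1.le, integral_Ioc_eq_integral_Ioo]
    congr 2
    ext x
    simp only [mem_inter_iff, mem_Iio, mem_Ioc, mem_Ioo]
    exact ⟨fun hx => ⟨hx.2.1, hx.1⟩, fun hx => ⟨hx.2, hx.1, hx.2.le.trans hv.2⟩⟩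
  have integral_right : ∀ u ∈ Ioc a b, ∫ v, G (u, v) ∂μ = (∫ v in u..b, h v) * w u := by
    intro u hu
    rw [slice_right, integral_indicator measurableSet_Ioi, hμ,
      Measure.restrict_restrict measurableSet_Ioi, intervalIntegral.integral_of_le hu.2,
      integral_const_mul, mul_comm]
    congr 3
    ext x
    simp only [mem_inter_iff, mem_Ioi, mem_Ioc]
    exact ⟨fun hx => ⟨hx.1, hx.2.2⟩, fun hx => ⟨hx.1, hu.1.trans hx.1, hx.2⟩⟩
  have hmem : ∀ᵐ x ∂μ, x ∈ Ioc a b := ae_restrict_mem measurableSet_Ioc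
  have hGint : Integrable G (μ.prod μ) := by
    rw [integrable_prod_iff' hGm]
    refine ⟨Filter.Eventually.of_forall fun v => ?_, hint.congr ?_⟩
    · rw [slice_left]
      exact (hw.mul_const (h v)).indicator measurableSet_Iio
    · filter_upwards [hmem] with v hv
      have : (fun u => ‖G (u, v)‖) = (Iio v).indicator (fun u => |w u| * |h v|) := by
        ext u
        rw [congrFun (slice_left v) u, norm_indicator_eq_indicator_norm]
        simp
      rw [this, integral_left _ v hv, intervalIntegral.integral_mul_const, mul_comm]
  refine ⟨hGint.integral_prod_left.congr ?_, ?_⟩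
  · filter_upwards [hmem] with u hu using integral_right u hu
  · rw [intervalIntegral.integral_of_le hab, intervalIntegral.integral_of_le hab]
    calc ∫ u, (∫ v in u..b, h v) * w u ∂μ = ∫ u, ∫ v, G (u, v) ∂μ ∂μ :=
          integral_congr_ae <| by
            filter_upwards [hmem] with u hu using (integral_right u hu).symm
      _ = ∫ v, ∫ u, G (u, v) ∂μ ∂μ := integral_integral_swap hGint
      _ = ∫ v, (h v * ∫ u in a..v, w u) ∂μ := integral_congr_ae <| by
          filter_upwards [hmem] with v hv
          rw [slice_left, integral_left _ v hv, intervalIntegral.integral_mul_const, mul_comm]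

/-- `α¹` is a left inverse of `β¹` on `L²([0,T], z² ds)`: for every `f` in this space,
`α¹(β¹ f) = f` almost everywhere on `(0,T)`, where
`(α¹ g)(s) = g(s) − A(s)⁻¹ ∫₀ˢ g(u) z(u)² du` and
`(β¹ f)(s) = f(s) − ∫ₛᵀ (f(u)/A(u)) z(u)² du`. -/
theorem alpha1_left_inverse_beta1
    (T : ℝ) (hT : 0 < T)
    (z : ℝ → ℝ) (hz : Measurable z)
    (hz2 : IntegrableOn (fun s => z s ^ 2) (Set.Ioc 0 T))
    (hzne : ∀ᵐ s ∂(volume.restrict (Set.Ioc 0 T)), z s ≠ 0)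
    (A : ℝ → ℝ) (hA : ∀ t, A t = ∫ s in (0:ℝ)..t, z s ^ 2)
    (f : ℝ → ℝ) (hf : Measurable f)
    (hfL2 : IntegrableOn (fun s => f s ^ 2 * z s ^ 2) (Set.Ioc 0 T)) :
    ∀ᵐ s ∂(volume.restrict (Set.Ioo 0 T)),
      (f s - ∫ v in s..T, (f v / A v) * z v ^ 2)
        - (A s)⁻¹ * ∫ u in (0:ℝ)..s,
            (f u - ∫ v in u..T, (f v / A v) * z v ^ 2) * z u ^ 2
      = f s := by
  have hz2' : ∀ t ∈ Icc 0 T, IntervalIntegrable (fun s => z s ^ 2) volume 0 t := fun t ht =>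
    (intervalIntegrable_iff_integrableOn_Ioc_of_le ht.1).2
      (hz2.mono_set (Ioc_subset_Ioc_right ht.2))
  have hApos : ∀ t ∈ Ioc 0 T, 0 < A t := by
    intro t ht
    rw [hA, intervalIntegral.integral_of_le ht.1.le,
      setIntegral_pos_iff_support_of_nonneg_ae
        (Filter.Eventually.of_forall fun s => sq_nonneg (z s))
        (hz2.mono_set (Ioc_subset_Ioc_right ht.2))]
    have hsub : (Ioc 0 t : Set ℝ) ≤ᵐ[volume]
        (Function.support (fun s => z s ^ 2) ∩ Ioc 0 t : Set ℝ) := by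
      filter_upwards [(ae_restrict_iff' measurableSet_Ioc).1 hzne] with x hx hxt
      exact ⟨pow_ne_zero 2 (hx ⟨hxt.1, hxt.2.trans ht.2⟩), hxt⟩
    refine lt_of_lt_of_le ?_ (measure_mono_ae hsub)
    simpa using ht.1
  have hAmono : ∀ s ∈ Ioc 0 T, ∀ t ∈ Icc s T, A s ≤ A t := by
    intro s hs t ht
    rw [hA, hA]
    exact intervalIntegral.integral_mono_interval le_rfl hs.1.le ht.1
      (Filter.Eventually.of_forall fun s => sq_nonneg (z s)) (hz2' t ⟨hs.1.le.trans ht.1, ht.2⟩)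
  have hAcont : ContinuousOn A (Icc 0 T) := by
    have := intervalIntegral.continuousOn_primitive_interval (μ := volume) (a := 0) (b := T)
      (f := fun s => z s ^ 2)
      (by rw [uIcc_of_le hT.le]; exact (integrableOn_Icc_iff_integrableOn_Ioc (by simp)).2 hz2)
    rw [uIcc_of_le hT.le] at this
    exact this.congr fun t _ => hA t
  have hAm : AEStronglyMeasurable A (volume.restrict (Ioc 0 T)) :=
    (hAcont.mono Ioc_subset_Icc_self).aestronglyMeasurable measurableSet_Ioc
  have hfz : IntegrableOn (fun s => f s * z s ^ 2) (Ioc 0 T) := by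
    refine Integrable.mono' (hfL2.add hz2) (hf.mul (hz.pow_const 2)).aestronglyMeasurable
      (Filter.Eventually.of_forall fun s => ?_)
    have h1 : |f s| ≤ f s ^ 2 + 1 := by nlinarith [sq_abs (f s), sq_nonneg (|f s| - 1)]
    have h2 := mul_le_mul_of_nonneg_right h1 (sq_nonneg (z s))
    simp only [Real.norm_eq_abs, abs_mul, abs_of_nonneg (sq_nonneg (z s)), Pi.add_apply]
    linarith
  set h : ℝ → ℝ := fun v => (f v / A v) * z v ^ 2 with hh
  have hhm : AEStronglyMeasurable h (volume.restrict (Ioc 0 T)) :=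
    ((hf.aestronglyMeasurable.aemeasurable.div hAm.aemeasurable).mul
      (hz.pow_const 2).aemeasurable).aestronglyMeasurable
  have hhA : ∀ v ∈ Ioc 0 T, h v * A v = f v * z v ^ 2 := by
    intro v hv
    have := (hApos v hv).ne'
    simp only [hh]
    field_simp
  have hhint : ∀ s ∈ Ioc 0 T, IntegrableOn h (Ioc s T) := by
    intro s hs
    have hsub : Ioc s T ⊆ Ioc 0 T := Ioc_subset_Ioc_left hs.1.le
    refine Integrable.mono' ((hfz.mono_set hsub).norm.const_mul (A s)⁻¹)
      (hhm.mono_set hsub) ?_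
    filter_upwards [ae_restrict_mem measurableSet_Ioc] with v hv
    have hAs := hApos s hs
    have hle := hAmono s hs v ⟨hv.1.le, hv.2⟩
    rw [← hhA v (hsub hv), norm_mul (h v), Real.norm_of_nonneg (hAs.le.trans hle), inv_mul_eq_div,
      le_div_iff₀ hAs]
    exact mul_le_mul_of_nonneg_left hle (norm_nonneg _)
  filter_upwards [ae_restrict_mem measurableSet_Ioo] with s hs
  have hs' : s ∈ Ioc 0 T := ⟨hs.1, hs.2.le⟩
  have hsub : Ioc 0 s ⊆ Ioc 0 T := Ioc_subset_Ioc_right hs.2.le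
  obtain ⟨hFint, hF⟩ := integrableOn_and_integral_triangle hs.1.le (w := fun u => z u ^ 2)
    (hz2.mono_set hsub) (hhm.mono_set hsub) (by
      refine (hfz.mono_set hsub).norm.congr ?_
      filter_upwards [ae_restrict_mem measurableSet_Ioc] with v hv
      simp only [abs_of_nonneg (sq_nonneg (z _)), ← hA]
      rw [← hhA v (hsub hv), norm_mul (h v), Real.norm_of_nonneg (hApos v (hsub hv)).le,
        Real.norm_eq_abs])
  have key : ∫ u in (0:ℝ)..s, (f u - ∫ v in u..T, h v) * z u ^ 2
      = -(A s * ∫ v in s..T, h v) := by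
    have hsplit : ∫ u in (0:ℝ)..s, (f u - ∫ v in u..T, h v) * z u ^ 2
        = ∫ u in (0:ℝ)..s, (f u * z u ^ 2 - (∫ v in u..s, h v) * z u ^ 2
            - (∫ v in s..T, h v) * z u ^ 2) := by
      rw [intervalIntegral.integral_of_le hs.1.le, intervalIntegral.integral_of_le hs.1.le]
      refine setIntegral_congr_fun measurableSet_Ioc fun u hu => ?_
      have hu' := hhint u (hsub hu)
      have hadd := intervalIntegral.integral_add_adjacent_intervals (μ := volume)
        ((intervalIntegrable_iff_integrableOn_Ioc_of_le hu.2).2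
          (hu'.mono_set (Ioc_subset_Ioc_right hs.2.le)))
        ((intervalIntegrable_iff_integrableOn_Ioc_of_le hs.2.le).2 (hhint s hs'))
      simp only [← hadd]
      ring
    have hfz' : IntervalIntegrable (fun u => f u * z u ^ 2) volume 0 s :=
      (intervalIntegrable_iff_integrableOn_Ioc_of_le hs.1.le).2 (hfz.mono_set hsub)
    have hFint' : IntervalIntegrable (fun u => (∫ v in u..s, h v) * z u ^ 2) volume 0 s :=
      (intervalIntegrable_iff_integrableOn_Ioc_of_le hs.1.le).2 hFint
    have hcongr : ∫ v in (0:ℝ)..s, h v * ∫ u in (0:ℝ)..v, z u ^ 2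
        = ∫ v in (0:ℝ)..s, f v * z v ^ 2 := by
      rw [intervalIntegral.integral_of_le hs.1.le, intervalIntegral.integral_of_le hs.1.le]
      refine setIntegral_congr_fun measurableSet_Ioc fun v hv => ?_
      simp only [← hA]
      exact hhA v (hsub hv)
    rw [hsplit, intervalIntegral.integral_sub (hfz'.sub hFint')
      ((hz2' s ⟨hs.1.le, hs.2.le⟩).const_mul _), intervalIntegral.integral_sub hfz' hFint',
      hF, hcongr, intervalIntegral.integral_const_mul, ← hA]
    ring
  have hAs := (hApos s hs').ne'
  rw [key]
  field_simp
  ring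
end

section
/- Composing β¹ with α¹ yields the mean-centering projection η: for every f ∈ L²_T, (β¹(α¹f))(s) = f(s) − A(T)⁻¹ ∫₀^T f(u) z(u)² du for almost every s ∈ (0,T), where (α¹f)(s) = f(s) − A(s)⁻¹ ∫₀^s f(u) z(u)² du and (β¹g)(s) = g(s) − ∫_s^T (g(u)/A(u)) z(u)² du. -/
open MeasureTheory Set

/-- The inverse of a nowhere vanishing absolutely continuous function is absolutely continuous. -/
theorem AbsolutelyContinuousOnInterval.fun_inv_of_ne_zero {f : ℝ → ℝ} {a b : ℝ}
    (hf : AbsolutelyContinuousOnInterval f a b) (h0 : ∀ x ∈ uIcc a b, f x ≠ 0) :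
    AbsolutelyContinuousOnInterval (fun x ↦ (f x)⁻¹) a b := by
  obtain ⟨C, hC⟩ := isCompact_uIcc.exists_bound_of_continuousOn (hf.continuousOn.inv₀ h0)
  unfold AbsolutelyContinuousOnInterval at hf ⊢
  apply squeeze_zero' ?_ ?_ (by simpa using hf.const_mul (C * C))
  · exact Filter.Eventually.of_forall fun _ ↦ Finset.sum_nonneg fun i hi ↦ dist_nonneg
  rw [Filter.eventually_inf_principal]
  filter_upwards with (n, I) hnI
  simp only [AbsolutelyContinuousOnInterval.disjWithin, mem_ofPred_eq] at hnI
  simp only [Finset.mul_sum]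
  gcongr with i hi
  obtain ⟨h1, h2⟩ := hnI.left i hi
  have hC0 : 0 ≤ C := (norm_nonneg _).trans (hC _ h1)
  rw [dist_inv_inv₀ (h0 _ h1) (h0 _ h2), div_eq_mul_inv, mul_inv, ← norm_inv, ← norm_inv, mul_comm]
  gcongr
  exacts [hC _ h1, hC _ h2]

/-- The quotient rule integrated: for indefinite integrals `F` of `p` and `A` of `q`, the function
`(p - (F / A) q) / A` integrates to the increment of `F / A`. -/
theorem integral_quotient_of_integrals {p q : ℝ → ℝ} {c a b : ℝ}
    (hp : IntervalIntegrable p volume c b) (hq : IntervalIntegrable q volume c b)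
    (hab : a ∈ uIcc c b) (h0 : ∀ x ∈ uIcc a b, ∫ v in c..x, q v ≠ 0) :
    ∫ u in a..b, (p u - (∫ v in c..u, q v)⁻¹ * (∫ v in c..u, p v) * q u) / (∫ v in c..u, q v) =
      (∫ v in c..b, p v) * (∫ v in c..b, q v)⁻¹ - (∫ v in c..a, p v) * (∫ v in c..a, q v)⁻¹ := by
  have hsub : uIcc a b ⊆ uIcc c b := uIcc_subset_uIcc hab right_mem_uIcc
  have hF := (hp.absolutelyContinuousOnInterval_intervalIntegral left_mem_uIcc).mono hsub
  have hA := (hq.absolutelyContinuousOnInterval_intervalIntegral left_mem_uIcc).mono hsub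
  rw [← (hF.fun_mul (hA.fun_inv_of_ne_zero h0)).integral_deriv_eq_sub]
  apply intervalIntegral.integral_congr_ae
  filter_upwards [hp.ae_hasDerivAt_integral, hq.ae_hasDerivAt_integral] with x hx1 hx2 hx
  have hx' := uIoc_subset_uIcc hx
  have hne := h0 x hx'
  have hd := (hx1 (hsub hx') c left_mem_uIcc).fun_mul
    ((hx2 (hsub hx') c left_mem_uIcc).fun_inv hne)
  rw [hd.deriv]
  field_simp
  ring

/-- Composing `β¹` with `α¹` yields the mean-centering projection `η`: for every `f` in
`L²([0,T], z² ds)`, `β¹(α¹ f) = η f` almost everywhere on `(0,T)`, where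
`(α¹ f)(s) = f(s) − A(s)⁻¹ ∫₀ˢ f(u) z(u)² du`,
`(β¹ g)(s) = g(s) − ∫ₛᵀ (g(u)/A(u)) z(u)² du` and
`(η f)(s) = f(s) − A(T)⁻¹ ∫₀ᵀ f(u) z(u)² du`. -/
theorem beta1_comp_alpha1_eq_eta
    (T : ℝ) (hT : 0 < T)
    (z : ℝ → ℝ) (hz : Measurable z)
    (hz2 : IntegrableOn (fun s => z s ^ 2) (Set.Ioc 0 T))
    (hzne : ∀ᵐ s ∂(volume.restrict (Set.Ioc 0 T)), z s ≠ 0)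
    (A : ℝ → ℝ) (hA : ∀ t, A t = ∫ s in (0:ℝ)..t, z s ^ 2)
    (f : ℝ → ℝ) (hf : Measurable f)
    (hfL2 : IntegrableOn (fun s => f s ^ 2 * z s ^ 2) (Set.Ioc 0 T)) :
    ∀ᵐ s ∂(volume.restrict (Set.Ioo 0 T)),
      (f s - (A s)⁻¹ * ∫ v in (0:ℝ)..s, f v * z v ^ 2)
        - ∫ u in s..T,
            ((f u - (A u)⁻¹ * ∫ v in (0:ℝ)..u, f v * z v ^ 2) / A u) * z u ^ 2
      = f s - (A T)⁻¹ * ∫ u in (0:ℝ)..T, f u * z u ^ 2 := by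
  have hq : IntervalIntegrable (fun s ↦ z s ^ 2) volume 0 T :=
    (intervalIntegrable_iff_integrableOn_Ioc_of_le hT.le).2 hz2
  have hp : IntervalIntegrable (fun s ↦ f s * z s ^ 2) volume 0 T := by
    refine (intervalIntegrable_iff_integrableOn_Ioc_of_le hT.le).2 ?_
    refine Integrable.mono (hfL2.add hz2) (hf.mul (hz.pow_const 2)).aestronglyMeasurable ?_
    refine Filter.Eventually.of_forall fun x ↦ ?_
    simp only [Pi.add_apply, Real.norm_eq_abs, abs_mul]
    rw [abs_of_nonneg (by positivity : 0 ≤ f x ^ 2 * z x ^ 2 + z x ^ 2),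
      abs_of_nonneg (sq_nonneg (z x)), ← sq_abs (f x)]
    nlinarith [sq_nonneg (z x), mul_nonneg (sq_nonneg (|f x| - 1)) (sq_nonneg (z x)),
      mul_nonneg (sq_nonneg |f x|) (sq_nonneg (z x))]
  have hpos : ∀ x ∈ Ioc 0 T, 0 < ∫ v in (0:ℝ)..x, z v ^ 2 := by
    intro x hx
    have hqx := hz2.mono_set (Ioc_subset_Ioc_right hx.2)
    rw [intervalIntegral.integral_of_le hx.1.le, integral_pos_iff_support_of_nonneg
      (fun _ ↦ sq_nonneg _) hqx, pos_iff_ne_zero]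
    intro h
    have hz0 : ∀ᵐ s ∂(volume.restrict (Ioc 0 x)), z s ≠ 0 :=
      ae_restrict_of_ae_restrict_of_subset (Ioc_subset_Ioc_right hx.2) hzne
    have hfalse : ∀ᵐ s ∂(volume.restrict (Ioc 0 x)), False := by
      filter_upwards [hz0, measure_eq_zero_iff_ae_notMem.1 h] with s hs hs'
      exact hs' (by simpa using hs)
    rw [Filter.eventually_false_iff_eq_bot, ae_eq_bot, Measure.restrict_eq_zero,
      Real.volume_Ioc] at hfalse
    simp only [sub_zero, ENNReal.ofReal_eq_zero] at hfalse
    exact hx.1.not_ge hfalse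
  refine (ae_restrict_mem measurableSet_Ioo).mono fun s hs ↦ ?_
  have key := integral_quotient_of_integrals (a := s) hp hq
    (by rw [uIcc_of_le hT.le]; exact Ioo_subset_Icc_self hs) (fun x hx ↦ (hpos x (by
      rw [uIcc_of_le hs.2.le] at hx; exact ⟨hs.1.trans_le hx.1, hx.2⟩)).ne')
  simp only [← hA] at key
  have hcongr : ∀ u, ((f u - (A u)⁻¹ * ∫ v in (0:ℝ)..u, f v * z v ^ 2) / A u) * z u ^ 2 =
      (f u * z u ^ 2 - (A u)⁻¹ * (∫ v in (0:ℝ)..u, f v * z v ^ 2) * z u ^ 2) / A u :=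
    fun u ↦ by ring
  simp only [hcongr, key]
  ring
end

section
/- The operator β² defined by (β²f)(s) = f(s) − ∫₀^s (f(u)/(A(T) − A(u))) z(u)² du maps L²_T isometrically into the mean-zero subspace: for every f ∈ L²_T one has ∫₀^T (β²f)(s) z(s)² ds = 0 and ∫₀^T (β²f)(s)² z(s)² ds = ∫₀^T f(s)² z(s)² ds. -/
open MeasureTheory Set
open Filter Topology

/-- The fundamental theorem of calculus for an absolutely continuous function whose derivative is
known almost everywhere. -/
lemma AbsolutelyContinuousOnInterval.integral_eq_sub_of_ae_hasDerivAt {F φ : ℝ → ℝ} {a b : ℝ}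
    (hF : AbsolutelyContinuousOnInterval F a b)
    (hφ : ∀ᵐ x, x ∈ uIcc a b → HasDerivAt F (φ x) x) :
    ∫ x in a..b, φ x = F b - F a := by
  rw [← hF.integral_deriv_eq_sub]
  apply intervalIntegral.integral_congr_ae
  filter_upwards [hφ] with x hx hxab
  exact (hx (uIoc_subset_uIcc hxab)).deriv.symm

section Truncated

variable {t c : ℝ} {f w : ℝ → ℝ}

lemma absolutelyContinuousOnInterval_const_sub_primitive (hw : IntervalIntegrable w volume 0 t) :
    AbsolutelyContinuousOnInterval (fun s => c - ∫ u in (0:ℝ)..s, w u) 0 t :=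
  AbsolutelyContinuousOnInterval.fun_sub
    ((LipschitzWith.const c).lipschitzOnWith.absolutelyContinuousOnInterval)
    (hw.absolutelyContinuousOnInterval_intervalIntegral (by simp))

lemma intervalIntegrable_div_const_sub_primitive (hw : IntervalIntegrable w volume 0 t)
    (hfw : IntervalIntegrable (fun s => f s * w s) volume 0 t)
    (hc : ∀ s ∈ uIcc 0 t, c - ∫ u in (0:ℝ)..s, w u ≠ 0) :
    IntervalIntegrable (fun s => f s / (c - ∫ u in (0:ℝ)..s, w u) * w s) volume 0 t := by
  have hB := (absolutelyContinuousOnInterval_const_sub_primitive (c := c) hw).continuousOn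
  refine (hfw.mul_continuousOn (hB.inv₀ hc)).congr fun s _ => ?_
  simp only [div_eq_mul_inv, Pi.inv_apply]
  ring

lemma integral_sub_primitive_div_mul (hw : IntervalIntegrable w volume 0 t)
    (hfw : IntervalIntegrable (fun s => f s * w s) volume 0 t)
    (hc : ∀ s ∈ uIcc 0 t, c - ∫ u in (0:ℝ)..s, w u ≠ 0) :
    ∫ s in (0:ℝ)..t, (f s - ∫ u in (0:ℝ)..s, f u / (c - ∫ v in (0:ℝ)..u, w v) * w u) * w s =
      (∫ u in (0:ℝ)..t, f u / (c - ∫ v in (0:ℝ)..u, w v) * w u) *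
        (c - ∫ u in (0:ℝ)..t, w u) := by
  have hh := intervalIntegrable_div_const_sub_primitive hw hfw hc
  have hG := hh.absolutelyContinuousOnInterval_intervalIntegral (c := 0) (by simp)
  have hB := absolutelyContinuousOnInterval_const_sub_primitive (c := c) hw
  rw [(hG.fun_mul hB).integral_eq_sub_of_ae_hasDerivAt]
  · simp
  · filter_upwards [hh.ae_hasDerivAt_integral, hw.ae_hasDerivAt_integral] with x h1 h2 hx
    convert! (h1 hx 0 (by simp)).mul ((h2 hx 0 (by simp)).const_sub c) using 1
    have := hc x hx
    field_simp
    ring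

lemma integral_sub_primitive_div_sq_mul (hw : IntervalIntegrable w volume 0 t)
    (hfw : IntervalIntegrable (fun s => f s * w s) volume 0 t)
    (hf2w : IntervalIntegrable (fun s => f s ^ 2 * w s) volume 0 t)
    (hc : ∀ s ∈ uIcc 0 t, c - ∫ u in (0:ℝ)..s, w u ≠ 0) :
    IntervalIntegrable (fun s => (f s - ∫ u in (0:ℝ)..s,
      f u / (c - ∫ v in (0:ℝ)..u, w v) * w u) ^ 2 * w s) volume 0 t ∧
    ∫ s in (0:ℝ)..t,
        (f s - ∫ u in (0:ℝ)..s, f u / (c - ∫ v in (0:ℝ)..u, w v) * w u) ^ 2 * w s =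
      (∫ s in (0:ℝ)..t, f s ^ 2 * w s) -
        (∫ u in (0:ℝ)..t, f u / (c - ∫ v in (0:ℝ)..u, w v) * w u) ^ 2 *
          (c - ∫ u in (0:ℝ)..t, w u) := by
  have hh := intervalIntegrable_div_const_sub_primitive hw hfw hc
  have hG := hh.absolutelyContinuousOnInterval_intervalIntegral (c := 0) (by simp)
  have hB := absolutelyContinuousOnInterval_const_sub_primitive (c := c) hw
  set G : ℝ → ℝ := fun s => ∫ u in (0:ℝ)..s, f u / (c - ∫ v in (0:ℝ)..u, w v) * w u
  have hint : IntervalIntegrable (fun s => 2 * (f s * w s * G s) - w s * (G s * G s))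
      volume 0 t :=
    ((hfw.mul_continuousOn hG.continuousOn).const_mul 2).sub
      (hw.mul_continuousOn (hG.continuousOn.mul hG.continuousOn))
  have hFTC : ∫ s in (0:ℝ)..t, (2 * (f s * w s * G s) - w s * (G s * G s)) =
      G t ^ 2 * (c - ∫ u in (0:ℝ)..t, w u) := by
    rw [((hG.fun_mul hG).fun_mul hB).integral_eq_sub_of_ae_hasDerivAt]
    · simp [G, sq]
    · filter_upwards [hh.ae_hasDerivAt_integral, hw.ae_hasDerivAt_integral] with x h1 h2 hx
      have h1 := h1 hx 0 (by simp)
      convert! (h1.mul h1).mul ((h2 hx 0 (by simp)).const_sub c) using 1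
      have := hc x hx
      simp only [G, Pi.mul_apply]
      field_simp
      ring
  have heq : (fun s => (f s - G s) ^ 2 * w s) =
      fun s => f s ^ 2 * w s - (2 * (f s * w s * G s) - w s * (G s * G s)) := by
    funext s; ring
  change IntervalIntegrable (fun s => (f s - G s) ^ 2 * w s) volume 0 t ∧
    ∫ s in (0:ℝ)..t, (f s - G s) ^ 2 * w s = _
  rw [heq, intervalIntegral.integral_sub hf2w hint, hFTC]
  exact ⟨hf2w.sub hint, rfl⟩

end Truncated

/-- A weighted square integrable function is integrable against an integrable weight. -/
lemma IntegrableOn.mul_weight_of_sq {S : Set ℝ} {g w : ℝ → ℝ} (hw0 : ∀ s, 0 ≤ w s)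
    (hw : IntegrableOn w S) (hg : IntegrableOn (fun s => g s ^ 2 * w s) S)
    (hm : AEStronglyMeasurable (fun s => g s * w s) (volume.restrict S)) :
    IntegrableOn (fun s => g s * w s) S := by
  refine Integrable.mono' (hg.add hw) hm (Eventually.of_forall fun s => ?_)
  rw [Real.norm_eq_abs, abs_mul, abs_of_nonneg (hw0 s)]
  have : |g s| ≤ g s ^ 2 + 1 := by nlinarith [sq_abs (g s), sq_nonneg (|g s| - 1), abs_nonneg (g s)]
  have := mul_le_mul_of_nonneg_right this (hw0 s)
  simp only [Pi.add_apply]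
  linarith

lemma tendsto_intervalIntegral_right {T : ℝ} {φ : ℝ → ℝ} {u : ℕ → ℝ}
    (hT : 0 ≤ T) (hφ : IntegrableOn φ (Ioc 0 T)) (hu : ∀ n, u n ∈ Ioo 0 T)
    (hlim : Tendsto u atTop (𝓝 T)) :
    Tendsto (fun n => ∫ s in (0:ℝ)..u n, φ s) atTop (𝓝 (∫ s in (0:ℝ)..T, φ s)) := by
  have hφ' : IntervalIntegrable φ volume 0 T :=
    (intervalIntegrable_iff_integrableOn_Ioc_of_le hT).2 hφ
  have hcont := intervalIntegral.continuousOn_primitive_interval' (a := 0) hφ' (by simp)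
  rw [uIcc_of_le hT] at hcont
  exact (hcont T ⟨hT, le_rfl⟩).tendsto.comp (tendsto_nhdsWithin_iff.2
    ⟨hlim, Eventually.of_forall fun n => Ioo_subset_Icc_self (hu n)⟩)

/-- The tail of the integral of an almost everywhere positive weight is positive. -/
lemma integral_sub_primitive_pos {T : ℝ} {w : ℝ → ℝ} (hw0 : ∀ s, 0 ≤ w s)
    (hw : IntegrableOn w (Ioc 0 T)) (hne : ∀ᵐ s ∂(volume.restrict (Ioc 0 T)), w s ≠ 0)
    {s : ℝ} (hs : s ∈ Ico 0 T) :
    0 < (∫ u in (0:ℝ)..T, w u) - ∫ u in (0:ℝ)..s, w u := by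
  have hT : 0 ≤ T := hs.1.trans hs.2.le
  have h0T : IntervalIntegrable w volume 0 T :=
    (intervalIntegrable_iff_integrableOn_Ioc_of_le hT).2 hw
  have h0s : IntervalIntegrable w volume 0 s :=
    (intervalIntegrable_iff_integrableOn_Ioc_of_le hs.1).2
      (hw.mono_set (Ioc_subset_Ioc_right hs.2.le))
  rw [intervalIntegral.integral_interval_sub_left h0T h0s,
    intervalIntegral.integral_pos_iff_support_of_nonneg_ae (Eventually.of_forall hw0)
      (h0s.symm.trans h0T)]
  refine ⟨hs.2, ?_⟩
  have hsub : Ioc s T ⊆ Ioc 0 T := Ioc_subset_Ioc_left hs.1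
  have hfull : (Function.support w ∩ Ioc s T : Set ℝ) =ᵐ[volume] Ioc s T := by
    filter_upwards [(ae_restrict_iff' measurableSet_Ioc).1 hne] with x hx
    refine propext ⟨fun h => h.2, fun h => ⟨hx (hsub h), h⟩⟩
  rw [measure_congr hfull, Real.volume_Ioc]
  simpa using hs.2

/-- The isometry into the mean-zero subspace, for a general integrable positive weight `w`. -/
lemma beta2_isometry_of_weight {T : ℝ} (hT : 0 < T) {w : ℝ → ℝ} (hw0 : ∀ s, 0 ≤ w s)
    (hw : IntegrableOn w (Ioc 0 T)) (hne : ∀ᵐ s ∂(volume.restrict (Ioc 0 T)), w s ≠ 0)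
    {f : ℝ → ℝ} (hf : Measurable f) (hf2w : IntegrableOn (fun s => f s ^ 2 * w s) (Ioc 0 T))
    {G : ℝ → ℝ} (hG : ∀ s, G s = ∫ u in (0:ℝ)..s,
      f u / ((∫ v in (0:ℝ)..T, w v) - ∫ v in (0:ℝ)..u, w v) * w u) :
    (∫ s in (0:ℝ)..T, (f s - G s) * w s) = 0 ∧
      (∫ s in (0:ℝ)..T, (f s - G s) ^ 2 * w s) = ∫ s in (0:ℝ)..T, f s ^ 2 * w s := by
  set B : ℝ → ℝ := fun s => (∫ v in (0:ℝ)..T, w v) - ∫ v in (0:ℝ)..s, w v with hBdef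
  have hBpos : ∀ s ∈ Ico 0 T, 0 < B s := fun s hs => integral_sub_primitive_pos hw0 hw hne hs
  have hfw : IntegrableOn (fun s => f s * w s) (Ioc 0 T) :=
    IntegrableOn.mul_weight_of_sq hw0 hw hf2w
      (hf.aestronglyMeasurable.mul hw.aestronglyMeasurable)
  have toInt : ∀ {φ : ℝ → ℝ} {t : ℝ}, IntegrableOn φ (Ioc 0 T) → t ∈ Ioo 0 T →
      IntervalIntegrable φ volume 0 t := fun hφ ht =>
    (intervalIntegrable_iff_integrableOn_Ioc_of_le ht.1.le).2
      (hφ.mono_set (Ioc_subset_Ioc_right ht.2.le))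
  have hBne : ∀ t ∈ Ioo 0 T, ∀ s ∈ uIcc 0 t, B s ≠ 0 := fun t ht s hs => by
    rw [uIcc_of_le ht.1.le] at hs
    exact (hBpos s ⟨hs.1, hs.2.trans_lt ht.2⟩).ne'
  have hmean : ∀ t ∈ Ioo 0 T, ∫ s in (0:ℝ)..t, (f s - G s) * w s = G t * B t := fun t ht => by
    have := integral_sub_primitive_div_mul (toInt hw ht) (toInt hfw ht) (hBne t ht)
    simpa only [← hG] using this
  have hsq : ∀ t ∈ Ioo 0 T, IntervalIntegrable (fun s => (f s - G s) ^ 2 * w s) volume 0 t ∧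
      ∫ s in (0:ℝ)..t, (f s - G s) ^ 2 * w s =
        (∫ s in (0:ℝ)..t, f s ^ 2 * w s) - G t ^ 2 * B t := fun t ht => by
    have := integral_sub_primitive_div_sq_mul (toInt hw ht) (toInt hfw ht) (toInt hf2w ht)
      (hBne t ht)
    simpa only [← hG] using this
  obtain ⟨u, -, hu, hlim⟩ := exists_seq_strictMono_tendsto' hT
  have hbound : ∀ t ∈ Ioo 0 T,
      ∫ s in (0:ℝ)..t, f s ^ 2 * w s ≤ ∫ s in (0:ℝ)..T, f s ^ 2 * w s := fun t ht => by
    rw [intervalIntegral.integral_of_le ht.1.le, intervalIntegral.integral_of_le hT.le]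
    exact setIntegral_mono_set hf2w
      (Eventually.of_forall fun s => mul_nonneg (sq_nonneg _) (hw0 s))
      (Ioc_subset_Ioc_right ht.2.le).eventuallyLE
  have hGB0 : ∀ t ∈ Ioo 0 T, 0 ≤ G t ^ 2 * B t := fun t ht =>
    mul_nonneg (sq_nonneg _) (hBpos t ⟨ht.1.le, ht.2⟩).le
  have hg2 : IntegrableOn (fun s => (f s - G s) ^ 2 * w s) (Ioc 0 T) := by
    refine integrableOn_Ioc_of_intervalIntegral_norm_bounded_right
      (I := ∫ s in (0:ℝ)..T, f s ^ 2 * w s) (fun n => ?_) hlim (Eventually.of_forall fun n => ?_)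
    · exact (intervalIntegrable_iff_integrableOn_Ioc_of_le (hu n).1.le).1 (hsq _ (hu n)).1
    · simp only [Real.norm_of_nonneg (mul_nonneg (sq_nonneg _) (hw0 _))]
      rw [← intervalIntegral.integral_of_le (hu n).1.le, (hsq _ (hu n)).2]
      linarith [hbound _ (hu n), hGB0 _ (hu n)]
  have hGcont : ∀ t ∈ Ioo 0 T, ContinuousOn G (Icc 0 t) := fun t ht => by
    have h := intervalIntegrable_div_const_sub_primitive (toInt hw ht) (toInt hfw ht) (hBne t ht)
    have := intervalIntegral.continuousOn_primitive_interval' (a := 0) h (by simp)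
    rw [uIcc_of_le ht.1.le] at this
    simpa only [← hG] using this
  have hg : IntegrableOn (fun s => (f s - G s) * w s) (Ioc 0 T) := by
    refine IntegrableOn.mul_weight_of_sq hw0 hw hg2 (.mul (hf.aestronglyMeasurable.sub ?_)
      hw.aestronglyMeasurable)
    refine (aecover_Ioc_of_Ioc tendsto_const_nhds hlim).aestronglyMeasurable fun n => ?_
    rw [Measure.restrict_restrict measurableSet_Ioc]
    exact (((hGcont _ (hu n)).aestronglyMeasurable measurableSet_Icc).mono_set
      Ioc_subset_Icc_self).mono_set inter_subset_left
  have hBlim : Tendsto (fun n => B (u n)) atTop (𝓝 0) := by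
    simpa [hBdef] using (tendsto_intervalIntegral_right hT.le hw hu hlim).const_sub
      (∫ v in (0:ℝ)..T, w v)
  have hglim := tendsto_intervalIntegral_right hT.le hg hu hlim
  have hg2lim := tendsto_intervalIntegral_right hT.le hg2 hu hlim
  have hf2lim := tendsto_intervalIntegral_right hT.le hf2w hu hlim
  have hzero : ∫ s in (0:ℝ)..T, (f s - G s) * w s = 0 := by
    have hle : (∫ s in (0:ℝ)..T, (f s - G s) * w s) ^ 2 ≤
        (∫ s in (0:ℝ)..T, f s ^ 2 * w s) * 0 := by
      refine le_of_tendsto_of_tendsto' (hglim.pow 2) (hBlim.const_mul _) fun n => ?_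
      have hpos : 0 ≤ B (u n) := (hBpos _ ⟨(hu n).1.le, (hu n).2⟩).le
      have h1 : 0 ≤ ∫ s in (0:ℝ)..u n, (f s - G s) ^ 2 * w s :=
        intervalIntegral.integral_nonneg (hu n).1.le
          fun s _ => mul_nonneg (sq_nonneg _) (hw0 s)
      have h2 : G (u n) ^ 2 * B (u n) ≤ ∫ s in (0:ℝ)..T, f s ^ 2 * w s := by
        linarith [hbound _ (hu n), (hsq _ (hu n)).2]
      rw [hmean _ (hu n)]
      nlinarith [mul_le_mul_of_nonneg_right h2 hpos]
    exact pow_eq_zero_iff two_ne_zero |>.1 (le_antisymm (by simpa using hle) (sq_nonneg _))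
  have htail : ∀ t ∈ Ioo 0 T, G t ^ 2 * B t ≤
      (∫ s in (0:ℝ)..T, (f s - G s) ^ 2 * w s) - ∫ s in (0:ℝ)..t, (f s - G s) ^ 2 * w s := by
    intro t ht
    have hcut : ∀ {φ : ℝ → ℝ}, IntegrableOn φ (Ioc 0 T) → IntervalIntegrable φ volume t T ∧
        (∫ s in (0:ℝ)..T, φ s) - ∫ s in (0:ℝ)..t, φ s = ∫ s in t..T, φ s := fun hφ => by
      have h0T := (intervalIntegrable_iff_integrableOn_Ioc_of_le hT.le).2 hφ
      exact ⟨(toInt hφ ht).symm.trans h0T,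
        intervalIntegral.integral_interval_sub_left h0T (toInt hφ ht)⟩
    have hnonneg : 0 ≤ ∫ s in t..T, ((f s - G s) ^ 2 * w s +
        (2 * G t * ((f s - G s) * w s) + G t ^ 2 * w s)) :=
      intervalIntegral.integral_nonneg ht.2.le fun s _ => by
        have := mul_nonneg (sq_nonneg (f s - G s + G t)) (hw0 s)
        linarith
    rw [intervalIntegral.integral_add (hcut hg2).1
        (((hcut hg).1.const_mul _).add ((hcut hw).1.const_mul _)),
      intervalIntegral.integral_add ((hcut hg).1.const_mul _) ((hcut hw).1.const_mul _),
      intervalIntegral.integral_const_mul, intervalIntegral.integral_const_mul,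
      ← (hcut hg2).2, ← (hcut hg).2, ← (hcut hw).2, hzero, hmean t ht] at hnonneg
    change 0 ≤ _ + (_ + G t ^ 2 * B t) at hnonneg
    linarith
  refine ⟨hzero, ?_⟩
  have htaillim := hg2lim.const_sub (∫ s in (0:ℝ)..T, (f s - G s) ^ 2 * w s)
  rw [sub_self] at htaillim
  have hGBlim : Tendsto (fun n => G (u n) ^ 2 * B (u n)) atTop (𝓝 0) :=
    squeeze_zero (fun n => hGB0 _ (hu n)) (fun n => htail _ (hu n)) htaillim
  refine tendsto_nhds_unique hg2lim ?_
  simpa using (hf2lim.sub hGBlim).congr fun n => (hsq _ (hu n)).2.symm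

/-- The operator `(β² f)(s) = f(s) − ∫₀ˢ (f(u)/(A(T) − A(u))) z(u)² du` maps
`L²([0,T], z² ds)` isometrically into the mean-zero subspace. -/
theorem beta2_isometry_into_mean_zero
    (T : ℝ) (hT : 0 < T)
    (z : ℝ → ℝ) (hz : Measurable z)
    (hz2 : IntegrableOn (fun s => z s ^ 2) (Set.Ioc 0 T))
    (hzne : ∀ᵐ s ∂(volume.restrict (Set.Ioc 0 T)), z s ≠ 0)
    (A : ℝ → ℝ) (hA : ∀ t, A t = ∫ s in (0:ℝ)..t, z s ^ 2)
    (f : ℝ → ℝ) (hf : Measurable f)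
    (hfL2 : IntegrableOn (fun s => f s ^ 2 * z s ^ 2) (Set.Ioc 0 T)) :
    (∫ s in (0:ℝ)..T, (f s - ∫ u in (0:ℝ)..s, (f u / (A T - A u)) * z u ^ 2) * z s ^ 2) = 0
    ∧ (∫ s in (0:ℝ)..T, (f s - ∫ u in (0:ℝ)..s, (f u / (A T - A u)) * z u ^ 2) ^ 2 * z s ^ 2)
        = ∫ s in (0:ℝ)..T, f s ^ 2 * z s ^ 2 := by
  obtain rfl : A = fun t => ∫ s in (0:ℝ)..t, z s ^ 2 := funext hA
  exact beta2_isometry_of_weight hT (fun s => sq_nonneg (z s)) hz2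
    (hzne.mono fun s hs => pow_ne_zero 2 hs) hf hfL2 fun _ => rfl
end

section
/- For the pair of operators (α²f)(s) = f(s) − (A(T) − A(s))⁻¹ ∫_s^T f(u) z(u)² du and (β²f)(s) = f(s) − ∫₀^s (f(u)/(A(T) − A(u))) z(u)² du on L²_T, one has for every f ∈ L²_T: (α²(β²f))(s) = f(s) for almost every s ∈ (0,T), and (β²(α²f))(s) = f(s) − A(T)⁻¹ ∫₀^T f(u) z(u)² du for almost every s ∈ (0,T). -/
open MeasureTheory Set

/-- Exchanging the order of integration over the triangle `a < v ≤ u ≤ b`. -/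
theorem integral_primitive_mul_eq_integral_mul_tail {w g : ℝ → ℝ} {a b : ℝ} (hab : a ≤ b)
    (hw : ∀ x, 0 ≤ w x) (hwi : IntegrableOn w (Ioc a b))
    (hgm : AEStronglyMeasurable g (volume.restrict (Ioc a b)))
    (hg : IntegrableOn (fun v => g v * ∫ u in v..b, w u) (Ioc a b)) :
    IntervalIntegrable (fun u => (∫ v in a..u, g v) * w u) volume a b ∧
      ∫ u in a..b, (∫ v in a..u, g v) * w u = ∫ v in a..b, g v * ∫ u in v..b, w u := by
  set μ := volume.restrict (Ioc a b) with hμ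
  let k : ℝ × ℝ → ℝ := {p : ℝ × ℝ | p.2 ≤ p.1}.indicator fun p => g p.2 * w p.1
  have hkm : AEStronglyMeasurable k (μ.prod μ) :=
    (hgm.comp_snd.mul hwi.aestronglyMeasurable.comp_fst).indicator
      (measurableSet_le measurable_snd measurable_fst)
  have hk_fst (v : ℝ) : (fun u => k (u, v)) = (Ici v).indicator fun u => g v * w u := by
    ext u; simp [k, indicator]
  have hk_snd (u : ℝ) : (fun v => k (u, v)) = (Iic u).indicator fun v => g v * w u := by
    ext v; simp [k, indicator]
  have hsum (v : ℝ) (hv : v ∈ Ioc a b) (c : ℝ) :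
      ∫ u, (Ici v).indicator (fun u => c * w u) u ∂μ = c * ∫ u in v..b, w u := by
    rw [integral_indicator measurableSet_Ici, hμ, Measure.restrict_restrict measurableSet_Ici,
      show Ici v ∩ Ioc a b = Icc v b by
        ext x; simp only [mem_inter_iff, mem_Ici, mem_Ioc, mem_Icc]; grind,
      integral_Icc_eq_integral_Ioc, ← intervalIntegral.integral_of_le hv.2,
      intervalIntegral.integral_const_mul]
  have hki : Integrable k (μ.prod μ) := by
    rw [integrable_prod_iff' hkm]
    refine ⟨Filter.Eventually.of_forall fun v => ?_, ?_⟩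
    · rw [hk_fst]
      exact (hwi.const_mul _).indicator measurableSet_Ici
    · refine hg.norm.congr ?_
      filter_upwards [ae_restrict_mem measurableSet_Ioc] with v hv
      have h0 : 0 ≤ ∫ u in v..b, w u :=
        intervalIntegral.integral_nonneg hv.2 fun u _ => hw u
      rw [norm_mul, Real.norm_of_nonneg h0, ← hsum v hv]
      refine integral_congr_ae (Filter.Eventually.of_forall fun u => ?_)
      have := congrFun (hk_fst v) u
      simp only [this, norm_indicator_eq_indicator_norm, norm_mul, Real.norm_of_nonneg (hw _)]
  have hleft : (fun u => ∫ v, k (u, v) ∂μ) =ᵐ[μ] fun u => (∫ v in a..u, g v) * w u := by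
    filter_upwards [ae_restrict_mem measurableSet_Ioc] with u hu
    rw [hk_snd, integral_indicator measurableSet_Iic, hμ,
      Measure.restrict_restrict measurableSet_Iic,
      show Iic u ∩ Ioc a b = Ioc a u by
        ext x; simp only [mem_inter_iff, mem_Iic, mem_Ioc]; grind,
      integral_mul_const, intervalIntegral.integral_of_le hu.1.le]
  have hright : (fun v => ∫ u, k (u, v) ∂μ) =ᵐ[μ] fun v => g v * ∫ u in v..b, w u := by
    filter_upwards [ae_restrict_mem measurableSet_Ioc] with v hv
    rw [hk_fst, hsum v hv]
  refine ⟨?_, ?_⟩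
  · rw [intervalIntegrable_iff_integrableOn_Ioc_of_le hab]
    exact hki.integral_prod_left.congr hleft
  · rw [intervalIntegral.integral_of_le hab, intervalIntegral.integral_of_le hab,
      ← integral_congr_ae hleft, ← integral_congr_ae hright]
    exact integral_integral_swap hki


/-- For the pair of operators
`(α² f)(s) = f(s) − (A(T) − A(s))⁻¹ ∫ₛᵀ f(u) z(u)² du` and
`(β² f)(s) = f(s) − ∫₀ˢ (f(u)/(A(T) − A(u))) z(u)² du` on `L²([0,T], z² ds)`:
`α²(β² f) = f` a.e. on `(0,T)` and `β²(α² f) = η f` a.e. on `(0,T)`,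
where `(η f)(s) = f(s) − A(T)⁻¹ ∫₀ᵀ f(u) z(u)² du`. -/
theorem alpha2_beta2_inverse_relations
    (T : ℝ) (hT : 0 < T)
    (z : ℝ → ℝ) (hz : Measurable z)
    (hz2 : IntegrableOn (fun s => z s ^ 2) (Set.Ioc 0 T))
    (hzne : ∀ᵐ s ∂(volume.restrict (Set.Ioc 0 T)), z s ≠ 0)
    (A : ℝ → ℝ) (hA : ∀ t, A t = ∫ s in (0:ℝ)..t, z s ^ 2)
    (f : ℝ → ℝ) (hf : Measurable f)
    (hfL2 : IntegrableOn (fun s => f s ^ 2 * z s ^ 2) (Set.Ioc 0 T)) :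
    (∀ᵐ s ∂(volume.restrict (Set.Ioo 0 T)),
      (f s - ∫ v in (0:ℝ)..s, (f v / (A T - A v)) * z v ^ 2)
        - (A T - A s)⁻¹ * ∫ u in s..T,
            (f u - ∫ v in (0:ℝ)..u, (f v / (A T - A v)) * z v ^ 2) * z u ^ 2
      = f s)
    ∧ (∀ᵐ s ∂(volume.restrict (Set.Ioo 0 T)),
      (f s - (A T - A s)⁻¹ * ∫ v in s..T, f v * z v ^ 2)
        - ∫ u in (0:ℝ)..s,
            ((f u - (A T - A u)⁻¹ * ∫ v in u..T, f v * z v ^ 2) / (A T - A u)) * z u ^ 2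
      = f s - (A T)⁻¹ * ∫ u in (0:ℝ)..T, f u * z u ^ 2) := by
  set w : ℝ → ℝ := fun s => z s ^ 2 with hw_def
  have hw0 (x : ℝ) : 0 ≤ w x := sq_nonneg _
  have hwI : IntervalIntegrable w volume 0 T :=
    (intervalIntegrable_iff_integrableOn_Ioc_of_le hT.le).2 hz2
  have hwf : IntervalIntegrable (fun s => f s * w s) volume 0 T := by
    refine (intervalIntegrable_iff_integrableOn_Ioc_of_le hT.le).2 ((hfL2.add hz2).mono'
      (hf.mul (hz.pow_const 2)).aestronglyMeasurable (Filter.Eventually.of_forall fun x => ?_))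
    simp only [Pi.add_apply, norm_mul, Real.norm_of_nonneg (hw0 x), Real.norm_eq_abs]
    have : |f x| ≤ f x ^ 2 + 1 := by
      rw [abs_le]; constructor <;> nlinarith [sq_nonneg (f x - 1), sq_nonneg (f x + 1)]
    calc |f x| * w x ≤ (f x ^ 2 + 1) * w x := by gcongr
      _ = f x ^ 2 * z x ^ 2 + z x ^ 2 := by simp only [hw_def]; ring
  have hsub {a b : ℝ} (ha : a ∈ Icc 0 T) (hb : b ∈ Icc 0 T) : uIcc a b ⊆ uIcc 0 T := by
    rw [uIcc_of_le hT.le]; exact uIcc_subset_Icc ha hb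
  have h0m : (0 : ℝ) ∈ Icc 0 T := ⟨le_rfl, hT.le⟩
  have hTm : T ∈ Icc 0 T := ⟨hT.le, le_rfl⟩
  have hR {v : ℝ} (hv : v ∈ Icc 0 T) : A T - A v = ∫ u in v..T, w u := by
    rw [hA, hA]
    exact intervalIntegral.integral_interval_sub_left hwI (hwI.mono_set (hsub h0m hv))
  have hRpos {v : ℝ} (hv0 : 0 ≤ v) (hvT : v < T) : 0 < A T - A v := by
    have hvm : v ∈ Icc 0 T := ⟨hv0, hvT.le⟩
    rw [hR hvm]
    refine lt_of_le_of_ne (intervalIntegral.integral_nonneg hvT.le fun u _ => hw0 u) fun h => ?_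
    have hwv := hwI.mono_set (hsub hvm hTm)
    have h1 := (intervalIntegral.integral_eq_zero_iff_of_le_of_nonneg_ae hvT.le
      (Filter.Eventually.of_forall hw0) hwv).1 h.symm
    have h2 := ae_restrict_of_ae_restrict_of_subset (Ioc_subset_Ioc_left hv0) hzne
    have h3 : ∀ᵐ x ∂volume.restrict (Ioc v T), False := by
      filter_upwards [h1, h2] with x hx hx'
      exact hx' (by simpa [hw_def] using hx)
    rw [Filter.eventually_false_iff_eq_bot, ae_eq_bot, Measure.restrict_eq_zero,
      Real.volume_Ioc, ENNReal.ofReal_eq_zero] at h3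
    linarith
  have hA0 : A 0 = 0 := by rw [hA]; simp
  have hAac : AbsolutelyContinuousOnInterval A 0 T := by
    rw [funext hA]
    exact hwI.absolutelyContinuousOnInterval_intervalIntegral left_mem_uIcc
  have hRac : AbsolutelyContinuousOnInterval (fun u => A T - A u) 0 T := by
    have hconst : AbsolutelyContinuousOnInterval (fun _ : ℝ => A T) 0 T :=
      (contDiff_const.contDiffOn).absolutelyContinuousOnInterval
    exact hconst.fun_sub hAac
  have hRinv {s : ℝ} (hs : s ∈ Ioo 0 T) :
      AbsolutelyContinuousOnInterval (fun u => (A T - A u)⁻¹) 0 s := by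
    have hsm : s ∈ Icc 0 T := ⟨hs.1.le, hs.2.le⟩
    refine (hRac.mono (hsub h0m hsm)).inv_of_le (hRpos hs.1.le hs.2) fun x hx => ?_
    rw [uIcc_of_le hs.1.le] at hx
    have hxm : x ∈ Icc 0 T := ⟨hx.1, hx.2.trans hs.2.le⟩
    rw [hR hsm, hR hxm, ← intervalIntegral.integral_add_adjacent_intervals
      (hwI.mono_set (hsub hxm hsm)) (hwI.mono_set (hsub hsm hTm))]
    linarith [intervalIntegral.integral_nonneg (μ := volume) hx.2 fun u _ => hw0 u]
  constructor
  · filter_upwards [ae_restrict_mem measurableSet_Ioo] with s hs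
    have hsm : s ∈ Icc 0 T := ⟨hs.1.le, hs.2.le⟩
    set g : ℝ → ℝ := fun v => f v / (A T - A v) * w v with hg_def
    have hRs := hRpos hs.1.le hs.2
    have hg0 : IntervalIntegrable g volume 0 s := by
      refine ((hwf.mono_set (hsub h0m hsm)).mul_continuousOn (hRinv hs).continuousOn).congr ?_
      exact fun x _ => by simp only [hg_def]; ring
    have hgm : AEStronglyMeasurable g (volume.restrict (Ioc 0 T)) := by
      have h1 : AEStronglyMeasurable (fun v => A T - A v) (volume.restrict (Ioc 0 T)) := by
        have h := hRac.continuousOn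
        rw [uIcc_of_le hT.le] at h
        exact (h.mono Ioc_subset_Icc_self).aestronglyMeasurable measurableSet_Ioc
      exact ((hf.aemeasurable.div h1.aemeasurable).mul
        (hz.pow_const 2).aemeasurable).aestronglyMeasurable
    have hgR : ∀ᵐ v ∂volume.restrict (Ioc s T), f v * w v = g v * ∫ u in v..T, w u := by
      have hne : ∀ᵐ v ∂volume.restrict (Ioc s T), v ≠ T :=
        ae_restrict_of_ae (Measure.ae_ne volume T)
      filter_upwards [ae_restrict_mem measurableSet_Ioc, hne] with v hv hvT
      have hv0 : 0 ≤ v := hs.1.le.trans hv.1.le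
      have hpos := hRpos hv0 (lt_of_le_of_ne hv.2 hvT)
      rw [← hR ⟨hv0, hv.2⟩]
      simp only [hg_def]
      field_simp
    have hwfs := hwf.mono_set (hsub hsm hTm)
    have hws := hwI.mono_set (hsub hsm hTm)
    obtain ⟨hi, he⟩ := integral_primitive_mul_eq_integral_mul_tail hs.2.le hw0
      ((intervalIntegrable_iff_integrableOn_Ioc_of_le hs.2.le).1 hws)
      (hgm.mono_measure (Measure.restrict_mono (Ioc_subset_Ioc_left hs.1.le) le_rfl))
      (((intervalIntegrable_iff_integrableOn_Ioc_of_le hs.2.le).1 hwfs).congr hgR)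
    have he' : ∫ u in s..T, (∫ v in s..u, g v) * w u = ∫ u in s..T, f u * w u := by
      rw [he, intervalIntegral.integral_of_le hs.2.le, intervalIntegral.integral_of_le hs.2.le]
      exact (integral_congr_ae hgR).symm
    have hsplit : ∫ u in s..T, (f u - ∫ v in (0:ℝ)..u, g v) * w u =
        ∫ u in s..T, (f u * w u - (∫ v in (0:ℝ)..s, g v) * w u) - (∫ v in s..u, g v) * w u := by
      refine intervalIntegral.integral_congr_ae ?_
      filter_upwards [Measure.ae_ne volume T] with u huT hu
      rw [uIoc_of_le hs.2.le] at hu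
      have huI : u ∈ Ioo 0 T := ⟨hs.1.trans hu.1, lt_of_le_of_ne hu.2 huT⟩
      have hgu : IntervalIntegrable g volume 0 u := by
        refine ((hwf.mono_set (hsub h0m ⟨huI.1.le, huI.2.le⟩)).mul_continuousOn
          (hRinv huI).continuousOn).congr ?_
        exact fun x _ => by simp only [hg_def]; ring
      rw [← intervalIntegral.integral_interval_sub_left hgu hg0]
      ring
    have hval : ∫ u in s..T, (f u - ∫ v in (0:ℝ)..u, g v) * w u =
        -((∫ v in (0:ℝ)..s, g v) * (A T - A s)) := by
      rw [hsplit, intervalIntegral.integral_sub (hwfs.sub (hws.const_mul _)) hi,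
        intervalIntegral.integral_sub hwfs (hws.const_mul _), he',
        intervalIntegral.integral_const_mul, hR hsm]
      ring
    rw [hval]
    field_simp
    ring
  · filter_upwards [ae_restrict_mem measurableSet_Ioo] with s hs
    have hsm : s ∈ Icc 0 T := ⟨hs.1.le, hs.2.le⟩
    set F : ℝ → ℝ := fun u => ∫ v in u..T, f v * w v with hF_def
    have hFeq {u : ℝ} (hu : u ∈ Icc 0 T) : F u = F 0 - ∫ v in (0:ℝ)..u, f v * w v := by
      have := intervalIntegral.integral_add_adjacent_intervals
        (hwf.mono_set (hsub h0m hu)) (hwf.mono_set (hsub hu hTm))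
      simp only [hF_def]
      linarith
    set P : ℝ → ℝ := fun u => F 0 - ∫ v in (0:ℝ)..u, f v * w v with hP_def
    have hPac : AbsolutelyContinuousOnInterval P 0 s := by
      have hconst : AbsolutelyContinuousOnInterval (fun _ : ℝ => F 0) 0 s :=
        (contDiff_const.contDiffOn).absolutelyContinuousOnInterval
      exact hconst.fun_sub ((hwf.mono_set
        (hsub h0m hsm)).absolutelyContinuousOnInterval_intervalIntegral left_mem_uIcc)
    have hparts := hPac.integral_deriv_mul_eq_sub (hRinv hs)
    have hcongr : ∫ u in (0:ℝ)..s, ((f u - (A T - A u)⁻¹ * F u) / (A T - A u)) * w u =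
        ∫ u in (0:ℝ)..s, -(deriv P u * (A T - A u)⁻¹ +
          P u * deriv (fun u => (A T - A u)⁻¹) u) := by
      refine intervalIntegral.integral_congr_ae ?_
      filter_upwards [hwf.ae_hasDerivAt_integral, hwI.ae_hasDerivAt_integral] with u h1 h2 hu
      rw [uIoc_of_le hs.1.le] at hu
      have hum : u ∈ Icc 0 T := ⟨hu.1.le, hu.2.trans hs.2.le⟩
      have hmem : u ∈ uIcc 0 T := by rwa [uIcc_of_le hT.le]
      have hpos := hRpos hum.1 (hu.2.trans_lt hs.2)
      have hdP : HasDerivAt P (-(f u * w u)) u := (h1 hmem 0 left_mem_uIcc).const_sub _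
      have hdA : HasDerivAt A (w u) u := by
        rw [funext hA]; exact h2 hmem 0 left_mem_uIcc
      have hdR := (hdA.const_sub (A T)).fun_inv hpos.ne'
      rw [hdP.deriv, hdR.deriv, hFeq hum]
      simp only [hP_def]
      field_simp
      ring
    have hPs : P s = F s := (hFeq hsm).symm
    have hP0 : P 0 = F 0 := by simp [hP_def]
    rw [hcongr, intervalIntegral.integral_neg, hparts, hA0, hP0, hPs, sub_zero]
    simp only [hF_def, hw_def]
    ring
end

section
/- The transformation built from β¹ preserves the martingale covariance: for all s, t ∈ (0,T], ∫₀^T (β¹ 1_{[0,s)})(u) (β¹ 1_{[0,t)})(u) z(u)² du = A(min(s,t)), where (β¹f)(u) = f(u) − ∫_u^T (f(v)/A(v)) z(v)² dv. (This expresses that the measure-preserving transformation T⁽¹⁾(M)_t = ∫₀^T (β¹1_{[0,t)})(s) dM_s of the Gaussian martingale M with ⟨M⟩ = A has the same covariance function Cov(M_s, M_t) = A(min(s,t)) as M.) -/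
open MeasureTheory Set

theorem continuousOn_mul_log_sq : ContinuousOn (fun x : ℝ => x * Real.log x ^ 2) (Ici 0) := by
  have h : Continuous (fun x : ℝ => (2 * (√x * Real.log √x)) ^ 2) := by
    have := Real.continuous_mul_log.comp Real.continuous_sqrt
    exact (continuous_const.mul this).pow 2
  refine h.continuousOn.congr fun x (hx : 0 ≤ x) => ?_
  simp only
  rw [Real.log_sqrt hx, mul_pow, mul_pow, Real.sq_sqrt hx]
  ring

theorem continuousOn_antideriv_log_sq (S : ℝ) :
    ContinuousOn (fun x : ℝ => x * Real.log x ^ 2 - 2 * (x * Real.log x) + 2 * x) (Icc 0 S) :=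
  ((continuousOn_mul_log_sq.mono Icc_subset_Ici_self).sub
    (continuous_const.mul Real.continuous_mul_log).continuousOn).add
    (continuous_const.mul continuous_id).continuousOn

theorem hasDerivAt_antideriv_log_sq {x : ℝ} (hx : x ≠ 0) :
    HasDerivAt (fun x : ℝ => x * Real.log x ^ 2 - 2 * (x * Real.log x) + 2 * x)
      (Real.log x ^ 2) x := by
  have hl := Real.hasDerivAt_log hx
  have hi := hasDerivAt_id' x
  refine (((hi.mul (hl.pow 2)).sub ((hi.mul hl).const_mul 2)).add
    (hi.const_mul 2)).congr_deriv ?_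
  simp only [Pi.pow_apply]
  field_simp
  push_cast
  ring

theorem intervalIntegrable_log_sq {S : ℝ} (hS : 0 ≤ S) :
    IntervalIntegrable (fun x => Real.log x ^ 2) volume 0 S := by
  rw [intervalIntegrable_iff_integrableOn_Ioc_of_le hS]
  exact intervalIntegral.integrableOn_deriv_of_nonneg (continuousOn_antideriv_log_sq S)
    (fun x hx => hasDerivAt_antideriv_log_sq hx.1.ne') fun x _ => sq_nonneg _

theorem integral_log_sq_from_zero {S : ℝ} (hS : 0 ≤ S) :
    ∫ x in (0 : ℝ)..S, Real.log x ^ 2 = S * Real.log S ^ 2 - 2 * (S * Real.log S) + 2 * S := by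
  rw [intervalIntegral.integral_eq_sub_of_hasDerivAt_of_le hS (continuousOn_antideriv_log_sq S)
    (fun x hx => hasDerivAt_antideriv_log_sq hx.1.ne') (intervalIntegrable_log_sq hS)]
  simp

theorem integral_add_log_mul_add_log {S : ℝ} (hS : 0 ≤ S) (a b : ℝ) :
    ∫ x in (0 : ℝ)..S, (a + Real.log x) * (b + Real.log x)
      = S * ((Real.log S + a - 1) * (Real.log S + b - 1) + 1) := by
  have h : ∀ x, (a + Real.log x) * (b + Real.log x)
      = Real.log x ^ 2 + ((a + b) * Real.log x + a * b) := fun x => by ring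
  have hl : IntervalIntegrable (fun x => (a + b) * Real.log x) volume 0 S :=
    intervalIntegral.intervalIntegrable_log'.const_mul _
  simp_rw [h]
  rw [intervalIntegral.integral_add (intervalIntegrable_log_sq hS)
      (hl.add intervalIntegrable_const),
    intervalIntegral.integral_add hl intervalIntegrable_const,
    intervalIntegral.integral_const_mul, integral_log_from_zero, integral_log_sq_from_zero hS,
    intervalIntegral.integral_const]
  simp only [smul_eq_mul]
  ring

/-- If `A` is a continuous strictly increasing primitive of `w ≥ 0` on `[a, b]`, then `A` pushes
the measure with density `w` on `(a, b]` forward to Lebesgue measure on `(A a, A b]`. -/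
theorem map_withDensity_primitive {w A : ℝ → ℝ} {a b : ℝ} (hab : a ≤ b) (hw0 : ∀ x, 0 ≤ w x)
    (hwi : IntegrableOn w (Ioc a b)) (hAc : ContinuousOn A (Icc a b))
    (hAm : StrictMonoOn A (Icc a b)) (hA : ∀ c ∈ Icc a b, ∫ x in a..c, w x = A c - A a) :
    ((volume.restrict (Ioc a b)).withDensity (fun x => ENNReal.ofReal (w x))).map A
      = volume.restrict (Ioc (A a) (A b)) := by
  have haI : a ∈ Icc a b := left_mem_Icc.2 hab
  have hbI : b ∈ Icc a b := right_mem_Icc.2 hab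
  have hae : AEMeasurable A
      ((volume.restrict (Ioc a b)).withDensity (fun x => ENNReal.ofReal (w x))) :=
    ((hAc.mono Ioc_subset_Icc_self).aemeasurable measurableSet_Ioc).mono_ac
      (withDensity_absolutelyContinuous _ _)
  have hfin : IsFiniteMeasure
      ((volume.restrict (Ioc a b)).withDensity (fun x => ENNReal.ofReal (w x))) :=
    isFiniteMeasure_withDensity_ofReal hwi.2
  have hIic : ∀ c ∈ Icc a b,
      ((volume.restrict (Ioc a b)).withDensity (fun x => ENNReal.ofReal (w x))) (Iic c)
        = ENNReal.ofReal (A c - A a) := by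
    intro c hc
    rw [withDensity_apply _ measurableSet_Iic, Measure.restrict_restrict measurableSet_Iic,
      inter_comm, Ioc_inter_Iic, inf_eq_right.2 hc.2,
      ← ofReal_integral_eq_lintegral_ofReal (hwi.mono_set (Ioc_subset_Ioc_right hc.2))
        (Filter.Eventually.of_forall hw0),
      ← intervalIntegral.integral_of_le hc.1, hA c hc]
  have hpre : ∀ x, ∀ c ∈ Icc a b, (∀ u ∈ Ioc a b, A u ≤ x ↔ u ≤ c) →
      ((volume.restrict (Ioc a b)).withDensity (fun x => ENNReal.ofReal (w x))) (A ⁻¹' Iic x)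
        = ENNReal.ofReal (A c - A a) := by
    intro x c hc h
    rw [← hIic c hc]
    refine measure_congr ((withDensity_absolutelyContinuous _ _).ae_le ?_)
    filter_upwards [ae_restrict_mem measurableSet_Ioc] with u hu
    exact propext (h u hu)
  refine Measure.ext_of_Iic _ _ fun x => ?_
  rw [Measure.map_apply_of_aemeasurable hae measurableSet_Iic,
    Measure.restrict_apply measurableSet_Iic, inter_comm, Ioc_inter_Iic, Real.volume_Ioc]
  rcases lt_or_ge x (A a) with hxa | hxa
  · rw [hpre x a haI fun u hu => ?_]
    · rw [ENNReal.ofReal_of_nonpos (by simp), ENNReal.ofReal_of_nonpos]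
      linarith [min_le_right (A b) x]
    · have := hAm haI (Ioc_subset_Icc_self hu) hu.1
      exact iff_of_false (by linarith) (not_le.2 hu.1)
  rcases le_or_gt (A b) x with hxb | hxb
  · rw [hpre x b hbI fun u hu => ?_, inf_eq_left.2 hxb]
    exact iff_of_true ((hAm.monotoneOn (Ioc_subset_Icc_self hu) hbI hu.2).trans hxb) hu.2
  · obtain ⟨c, hc, rfl⟩ := intermediate_value_Icc hab hAc ⟨hxa, hxb.le⟩
    rw [hpre _ c hc fun u hu => hAm.le_iff_le (Ioc_subset_Icc_self hu) hc, inf_eq_right.2 hxb.le]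

/-- Change of variables along a strictly increasing primitive of an integrable function. -/
theorem integral_comp_primitive_mul {w A h : ℝ → ℝ} {a b : ℝ} (hab : a ≤ b)
    (hwm : Measurable w) (hw0 : ∀ x, 0 ≤ w x)
    (hwi : IntegrableOn w (Ioc a b)) (hAc : ContinuousOn A (Icc a b))
    (hAm : StrictMonoOn A (Icc a b)) (hA : ∀ c ∈ Icc a b, ∫ x in a..c, w x = A c - A a)
    (hh : Measurable h) :
    ∫ u in a..b, h (A u) * w u = ∫ x in A a..A b, h x := by
  have hAab : A a ≤ A b :=
    hAm.monotoneOn (left_mem_Icc.2 hab) (right_mem_Icc.2 hab) hab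
  have hae : AEMeasurable A
      ((volume.restrict (Ioc a b)).withDensity (fun x => ENNReal.ofReal (w x))) :=
    ((hAc.mono Ioc_subset_Icc_self).aemeasurable measurableSet_Ioc).mono_ac
      (withDensity_absolutelyContinuous _ _)
  rw [intervalIntegral.integral_of_le hab, intervalIntegral.integral_of_le hAab,
    ← map_withDensity_primitive hab hw0 hwi hAc hAm hA,
    integral_map hae hh.aestronglyMeasurable,
    integral_withDensity_eq_integral_toReal_smul hwm.ennreal_ofReal
      (Filter.Eventually.of_forall fun _ => ENNReal.ofReal_lt_top)]
  refine integral_congr_ae (Filter.Eventually.of_forall fun u => ?_)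
  simp only [ENNReal.toReal_ofReal (hw0 u), smul_eq_mul]
  ring

/-- An interval integral whose integrand is cut off at `c` is an integral up to `c`. -/
theorem intervalIntegral_eq_of_cutoff {f g : ℝ → ℝ} {a b c : ℝ} (hac : a ≤ c) (hcb : c ≤ b)
    (hfg : ∀ x ∈ Ioo a c, f x = g x) (hf : ∀ x ∈ Icc c b, f x = 0) :
    ∫ x in a..b, f x = ∫ x in a..c, g x := by
  rw [intervalIntegral.integral_of_le (hac.trans hcb), intervalIntegral.integral_of_le hac,
    integral_Ioc_eq_integral_Ioo (y := c), ← setIntegral_congr_fun measurableSet_Ioo hfg]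
  refine setIntegral_eq_of_subset_of_forall_sdiff_eq_zero measurableSet_Ioc
    (fun x hx => ⟨hx.1, hx.2.le.trans hcb⟩) fun x hx => hf x ⟨?_, hx.1.2⟩
  by_contra! h
  exact hx.2 ⟨hx.1.1, h⟩

/-- The transformation built from `β¹` preserves the martingale covariance: for
`s, t ∈ (0,T]`, `∫₀ᵀ (β¹ 1_{[0,s)})(u) (β¹ 1_{[0,t)})(u) z(u)² du = A(min(s,t))`,
where `(β¹ f)(u) = f(u) − ∫ᵤᵀ (f(v)/A(v)) z(v)² dv`. -/
theorem beta1_transformation_preserves_covariance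
    (T : ℝ) (hT : 0 < T)
    (z : ℝ → ℝ) (hz : Measurable z)
    (hz2 : IntegrableOn (fun s => z s ^ 2) (Set.Ioc 0 T))
    (hzne : ∀ᵐ s ∂(volume.restrict (Set.Ioc 0 T)), z s ≠ 0)
    (A : ℝ → ℝ) (hA : ∀ t, A t = ∫ s in (0:ℝ)..t, z s ^ 2)
    (s t : ℝ) (hs0 : 0 < s) (hsT : s ≤ T) (ht0 : 0 < t) (htT : t ≤ T) :
    (∫ u in (0:ℝ)..T,
      (Set.indicator (Set.Ico 0 s) (fun _ => (1:ℝ)) u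
        - ∫ v in u..T, (Set.indicator (Set.Ico 0 s) (fun _ => (1:ℝ)) v / A v) * z v ^ 2)
      * (Set.indicator (Set.Ico 0 t) (fun _ => (1:ℝ)) u
        - ∫ v in u..T, (Set.indicator (Set.Ico 0 t) (fun _ => (1:ℝ)) v / A v) * z v ^ 2)
      * z u ^ 2)
    = A (min s t) := by
  have hw0 : ∀ x, 0 ≤ z x ^ 2 := fun x => sq_nonneg _
  have hwm : Measurable fun x => z x ^ 2 := hz.pow_const 2
  have hii : ∀ a b, 0 ≤ a → a ≤ b → b ≤ T → IntervalIntegrable (fun x => z x ^ 2) volume a b :=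
    fun a b ha hab hb => (intervalIntegrable_iff_integrableOn_Ioc_of_le hab).2
      (hz2.mono_set (Ioc_subset_Ioc ha hb))
  have hsub : ∀ a b, 0 ≤ a → a ≤ b → b ≤ T → ∫ x in a..b, z x ^ 2 = A b - A a := by
    intro a b ha hab hb
    rw [hA, hA, intervalIntegral.integral_interval_sub_left (hii 0 b le_rfl (ha.trans hab) hb)
      (hii 0 a le_rfl ha (hab.trans hb))]
  have hA0 : A 0 = 0 := by simp [hA]
  have hAc : ContinuousOn A (Icc 0 T) := by
    rw [funext hA]
    rw [← integrableOn_Icc_iff_integrableOn_Ioc, ← uIcc_of_le hT.le] at hz2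
    simpa only [uIcc_of_le hT.le] using intervalIntegral.continuousOn_primitive_interval hz2
  have hAm : StrictMonoOn A (Icc 0 T) := by
    intro a ha b hb hab
    rw [← sub_pos, ← hsub a b ha.1 hab.le hb.2,
      intervalIntegral.integral_pos_iff_support_of_nonneg_ae
        (Filter.Eventually.of_forall hw0) (hii a b ha.1 hab.le hb.2)]
    refine ⟨hab, ?_⟩
    have hae : (Function.support (fun x => z x ^ 2) ∩ Ioc a b : Set ℝ) =ᵐ[volume] Ioc a b := by
      rw [ae_restrict_iff' measurableSet_Ioc] at hzne
      filter_upwards [hzne] with x hx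
      refine propext ⟨fun h => h.2, fun h => ⟨?_, h⟩⟩
      exact pow_ne_zero 2 (hx ⟨ha.1.trans_lt h.1, h.2.trans hb.2⟩)
    rw [measure_congr hae, Real.volume_Ioc]
    simpa using hab
  have hcv : ∀ a b, 0 ≤ a → a ≤ b → b ≤ T → ∀ h : ℝ → ℝ, Measurable h →
      ∫ u in a..b, h (A u) * z u ^ 2 = ∫ x in A a..A b, h x := by
    intro a b ha hab hb h hh
    have hss := Icc_subset_Icc ha hb
    exact integral_comp_primitive_mul hab hwm hw0 (hz2.mono_set (Ioc_subset_Ioc ha hb))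
      (hAc.mono hss) (hAm.mono hss) (fun c hc => hsub a c ha hc.1 (hc.2.trans hb)) hh
  have hApos : ∀ u, 0 < u → u ≤ T → 0 < A u := fun u hu huT =>
    hA0 ▸ hAm (left_mem_Icc.2 hT.le) ⟨hu.le, huT⟩ hu
  have hβ : ∀ r, 0 < r → r ≤ T → ∀ u, 0 < u → u < r →
      Set.indicator (Set.Ico 0 r) (fun _ => (1:ℝ)) u
        - ∫ v in u..T, (Set.indicator (Set.Ico 0 r) (fun _ => (1:ℝ)) v / A v) * z v ^ 2
      = (1 - Real.log (A r)) + Real.log (A u) := by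
    intro r hr hrT u hu hur
    have hAu := hApos u hu (hur.le.trans hrT)
    have hAr := hApos r hr hrT
    rw [intervalIntegral_eq_of_cutoff (g := fun v => (A v)⁻¹ * z v ^ 2) hur.le hrT
        (fun v hv => ?_) (fun v hv => ?_),
      hcv u r hu.le hur.le hrT _ measurable_inv, integral_inv_of_pos hAu hAr,
      Real.log_div hAr.ne' hAu.ne', indicator_of_mem (show u ∈ Ico 0 r from ⟨hu.le, hur⟩)]
    · ring
    · rw [indicator_of_mem (show v ∈ Ico 0 r from ⟨hu.le.trans hv.1.le, hv.2⟩), one_div]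
    · rw [indicator_of_notMem fun h => hv.1.not_gt h.2]
      simp
  have hβ0 : ∀ r u, r ≤ u → u ≤ T →
      Set.indicator (Set.Ico 0 r) (fun _ => (1:ℝ)) u
        - ∫ v in u..T, (Set.indicator (Set.Ico 0 r) (fun _ => (1:ℝ)) v / A v) * z v ^ 2
      = 0 := by
    intro r u hru huT
    rw [intervalIntegral_eq_of_cutoff (g := 0) le_rfl huT (fun v hv => by simp at hv)
        (fun v hv => ?_), indicator_of_notMem fun h => hru.not_gt h.2]
    · simp
    · rw [indicator_of_notMem fun h => (hru.trans hv.1).not_gt h.2]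
      simp
  have hm0 : 0 < min s t := lt_min hs0 ht0
  have hmT : min s t ≤ T := (min_le_left s t).trans hsT
  rw [intervalIntegral_eq_of_cutoff
      (g := fun u => (((1 - Real.log (A s)) + Real.log (A u))
        * ((1 - Real.log (A t)) + Real.log (A u))) * z u ^ 2) hm0.le hmT
      (fun u hu => ?_) (fun u hu => ?_),
    hcv 0 _ le_rfl hm0.le hmT (fun x => ((1 - Real.log (A s)) + Real.log x)
        * ((1 - Real.log (A t)) + Real.log x))
      ((measurable_const.add Real.measurable_log).mul (measurable_const.add Real.measurable_log)),
    hA0, integral_add_log_mul_add_log (hApos _ hm0 hmT).le]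
  · rcases min_choice s t with h | h <;> rw [h] <;> ring
  · rw [hβ s hs0 hsT u hu.1 (hu.2.trans_le (min_le_left s t)),
      hβ t ht0 htT u hu.1 (hu.2.trans_le (min_le_right s t))]
  · rcases min_le_iff.1 hu.1 with h | h
    · rw [hβ0 s u h hu.2]
      simp
    · rw [hβ0 t u h hu.2]
      simp
end
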